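/- Let ℓ and k be positive integers and let f₁,…,f_k be pseudo-polynomials that are linearly independent over ℚ (no nontrivial rational linear combination of f₁,…,f_k is identically zero). Then there exist η > 0, C > 0 and N₀ ∈ ℕ, depending only on ℓ and f₁,…,f_k, such that for every real ℓ×k matrix A = (a_{ij}) and every integer N ≥ N₀ one has min_{1 ≤ n ≤ N} max_{1 ≤ i ≤ ℓ} ‖Σ_{j=1}^{k} a_{ij}⌊f_j(n)⌋‖ ≤ C·N^{−η}. -/

import Mathlib

/-- Distance from a real number to the nearest integer. -/
noncomputable def nearestIntDist (x : ℝ) : ℝ := |x - round x|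

/-- A pseudo-polynomial: `f(x) = α₁ x^{θ₁} + ⋯ + α_d x^{θ_d}` with all `αᵢ > 0`,
`1 ≤ θ₁ < ⋯ < θ_d`, and at least one `θⱼ` not an integer. -/
def IsPseudoPoly (f : ℝ → ℝ) : Prop :=
  ∃ (d : ℕ) (α θ : Fin (d + 1) → ℝ),
    (∀ i, 0 < α i) ∧ (1 ≤ θ 0) ∧ StrictMono θ ∧
    (∃ i, ∀ m : ℤ, θ i ≠ (m : ℝ)) ∧
    ∀ x : ℝ, f x = ∑ i, α i * x ^ (θ i)

namespace Heilbronn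

open Finset Polynomial

/-! ### Distance to the nearest integer -/

lemma nearestIntDist_le_abs_sub (x : ℝ) (m : ℤ) : nearestIntDist x ≤ |x - m| :=
  round_le x m

lemma nearestIntDist_nonneg (x : ℝ) : 0 ≤ nearestIntDist x := abs_nonneg _

lemma nearestIntDist_le_half (x : ℝ) : nearestIntDist x ≤ 1 / 2 := abs_sub_round x

lemma nearestIntDist_le_abs (x : ℝ) : nearestIntDist x ≤ |x| := by
  simpa using nearestIntDist_le_abs_sub x 0

lemma exists_eq_add_nearestIntDist (x : ℝ) :
    ∃ (m : ℤ) (s : ℝ), x = m + s ∧ |s| = nearestIntDist x :=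
  ⟨round x, x - round x, by ring, rfl⟩

lemma nearestIntDist_add_le (x y : ℝ) :
    nearestIntDist (x + y) ≤ nearestIntDist x + nearestIntDist y := by
  refine (nearestIntDist_le_abs_sub _ (round x + round y)).trans ?_
  have : x + y - ((round x + round y : ℤ) : ℝ) = (x - round x) + (y - round y) := by
    push_cast; ring
  rw [this]
  exact abs_add_le _ _

lemma nearestIntDist_int_mul_le (m : ℤ) (x : ℝ) :
    nearestIntDist (m * x) ≤ |(m : ℝ)| * nearestIntDist x := by
  refine (nearestIntDist_le_abs_sub _ (m * round x)).trans ?_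
  have : m * x - ((m * round x : ℤ) : ℝ) = m * (x - round x) := by
    push_cast; ring
  rw [this, abs_mul]
  rfl

lemma nearestIntDist_nat_mul_le (m : ℕ) (x : ℝ) :
    nearestIntDist (m * x) ≤ m * nearestIntDist x := by
  simpa using nearestIntDist_int_mul_le m x

lemma nearestIntDist_neg (x : ℝ) : nearestIntDist (-x) = nearestIntDist x := by
  apply le_antisymm
  · simpa using nearestIntDist_int_mul_le (-1) x
  · simpa using nearestIntDist_int_mul_le (-1) (-x)

lemma nearestIntDist_sub_le (x y : ℝ) :
    nearestIntDist (x - y) ≤ nearestIntDist x + nearestIntDist y := by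
  rw [sub_eq_add_neg, ← nearestIntDist_neg y]
  exact nearestIntDist_add_le _ _

lemma nearestIntDist_intCast (m : ℤ) : nearestIntDist (m : ℝ) = 0 := by
  simp [nearestIntDist]

lemma nearestIntDist_sum_le {ι : Type*} (s : Finset ι) (f : ι → ℝ) :
    nearestIntDist (∑ i ∈ s, f i) ≤ ∑ i ∈ s, nearestIntDist (f i) := by
  classical
  induction s using Finset.induction_on with
  | empty => simpa using (nearestIntDist_intCast 0).le
  | insert a s ha ih =>
    rw [sum_insert ha, sum_insert ha]
    exact (nearestIntDist_add_le _ _).trans (by gcongr)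

lemma nearestIntDist_eq_abs {x : ℝ} (hx : |x| ≤ 1 / 2) : nearestIntDist x = |x| := by
  apply le_antisymm (nearestIntDist_le_abs x)
  obtain ⟨m, s, h1, h2⟩ := exists_eq_add_nearestIntDist x
  rw [← h2]
  rcases eq_or_ne m 0 with rfl | hm
  · simp [h1]
  · have h3 : (1 : ℝ) ≤ |(m : ℝ)| := by exact_mod_cast Int.one_le_abs hm
    have h4 : (m : ℝ) = x - s := by rw [h1]; ring
    have := abs_sub x s
    rw [← h4] at this
    linarith

/-! ### Powers of a large parameter -/

lemma exists_le_pow (c : ℝ) : ∃ C : ℕ, ∀ R : ℝ, 2 ≤ R → c ≤ R ^ C := by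
  obtain ⟨C, hC⟩ := pow_unbounded_of_one_lt c (one_lt_two)
  exact ⟨C, fun R hR => hC.le.trans (by gcongr)⟩

/-! ### Density of near-returns -/

/-- If a dense set of `h ≤ N` satisfies `‖α h‖ ≤ ε`, then `α` is very close to a rational number
with small denominator. -/
lemma exists_small_denominator {R : ℝ} (hR : 2 ≤ R) {N : ℕ} (hN : 4 * R ≤ N) {S : Finset ℕ}
    (hS : ∀ h ∈ S, h < N) (hcard : N / R ≤ (S.card : ℝ)) {α ε : ℝ} (hε : ε < 1 / (32 * R))
    (hα : ∀ h ∈ S, nearestIntDist (α * h) ≤ ε) :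
    ∃ q : ℕ, 1 ≤ q ∧ (q : ℝ) ≤ 2 * R ∧ nearestIntDist (q * α) * N ≤ 16 * R ^ 2 * ε := by
  have hR0 : 0 < R := by linarith
  have hN0 : (0 : ℝ) < N := by linarith
  have hdiff : ∀ h ∈ S, ∀ h' ∈ S, nearestIntDist (α * h - α * h') ≤ 2 * ε := fun h hh h' hh' => by
    have := nearestIntDist_sub_le (α * h) (α * h')
    linarith [hα h hh, hα h' hh']
  have hSne : S.Nonempty := by
    rw [← card_pos]
    have : 0 < (S.card : ℝ) := lt_of_lt_of_le (by positivity) hcard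
    exact_mod_cast this
  have hε0 : 0 ≤ ε := by
    obtain ⟨h, hh⟩ := hSne
    exact (nearestIntDist_nonneg _).trans (hα h hh)
  obtain ⟨q, hq1, hq2, hq3⟩ : ∃ q : ℕ, 1 ≤ q ∧ (q : ℝ) ≤ 2 * R ∧
      nearestIntDist (q * α) ≤ 2 * ε := by
    set G := ⌈2 * R⌉₊ with hG
    have hG0 : 0 < G := Nat.ceil_pos.mpr (by linarith)
    have hG1 : 2 * R ≤ G := Nat.le_ceil _
    have hG2 : (G : ℝ) < 2 * R + 1 := Nat.ceil_lt_add_one (by linarith)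
    obtain ⟨x, hx, y, hy, hne, hxy⟩ : ∃ x ∈ S, ∃ y ∈ S, x ≠ y ∧ x / G = y / G := by
      apply exists_ne_map_eq_of_card_lt_of_maps_to (t := range (N / G + 1))
      · rw [card_range]
        have : ((N / G + 1 : ℕ) : ℝ) < S.card := by
          refine lt_of_lt_of_le ?_ hcard
          have h1 : ((N / G : ℕ) : ℝ) ≤ N / (2 * R) :=
            Nat.cast_div_le.trans (by gcongr)
          have h2 : (N : ℝ) / R = N / (2 * R) + N / (2 * R) := by field_simp; ring
          have h3 : 2 ≤ (N : ℝ) / (2 * R) := by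
            rw [le_div_iff₀ (by positivity)]; linarith
          push_cast
          linarith
        exact_mod_cast this
      · intro h hh
        simp only [coe_range, Set.mem_Iio]
        exact Nat.lt_succ_of_le (Nat.div_le_div_right (hS h hh).le)
    wlog hlt : y < x generalizing x y
    · exact this y hy x hx hne.symm hxy.symm (by omega)
    refine ⟨x - y, by omega, ?_, ?_⟩
    · have h1 := Nat.div_add_mod x G
      have h2 := Nat.div_add_mod y G
      have h3 := Nat.mod_lt x hG0
      rw [hxy] at h1
      have h4 : x - y + 1 ≤ G := by omega
      have h5 : ((x - y : ℕ) : ℝ) + 1 ≤ G := by exact_mod_cast h4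
      linarith
    · rw [Nat.cast_sub hlt.le]
      have := hdiff x hx y hy
      rwa [← mul_sub, mul_comm] at this
  refine ⟨q, hq1, hq2, ?_⟩
  set τ := nearestIntDist (q * α) with hτ
  have hτ0 : 0 ≤ τ := nearestIntDist_nonneg _
  rcases hτ0.eq_or_lt with h0 | hτpos
  · rw [← h0, zero_mul]; positivity
  have hτh : τ ≤ 1 / 2 := nearestIntDist_le_half _
  have hq0 : (1 : ℝ) ≤ q := by exact_mod_cast hq1
  have hεpos : 0 < ε := by linarith
  have key : ∀ B : ℕ, 1 ≤ B → B ≤ N → (B : ℝ) ≤ q / (2 * τ) → B * τ ≤ 8 * R * q * ε := by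
    intro B hB1 hBN hBτ
    have hfib : ∀ b ∈ S.image (fun h => (h / B, h % q)),
        (S.filter (fun h => (h / B, h % q) = b)).card ≤ ⌊2 * ε / τ⌋₊ + 1 := by
      intro b _
      rcases (S.filter (fun h => (h / B, h % q) = b)).eq_empty_or_nonempty with he | hne
      · simp [he]
      obtain ⟨h0, hh0, hmin⟩ := exists_min_image _ id hne
      simp only [id, mem_filter] at hh0 hmin
      rw [← card_range (⌊2 * ε / τ⌋₊ + 1)]
      have hdiv : ∀ h, h ∈ S ∧ (h / B, h % q) = b → ∃ m, h = h0 + q * m := by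
        intro h hh
        have h1 := hmin h hh
        have h2 : h % q = h0 % q := by
          rw [← hh0.2] at hh; exact (Prod.mk.inj hh.2).2
        have h3 : q ∣ h - h0 := (Nat.modEq_iff_dvd' h1).mp h2.symm
        obtain ⟨m, hm⟩ := h3
        exact ⟨m, by omega⟩
      apply card_le_card_of_injOn (fun h => (h - h0) / q)
      · intro h hh
        simp only [coe_filter, Set.mem_ofPred_eq] at hh
        obtain ⟨m, rfl⟩ := hdiv h hh
        simp only [coe_range, Set.mem_Iio]
        rw [Nat.add_sub_cancel_left, Nat.mul_div_cancel_left _ (by omega)]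
        refine Nat.lt_succ_of_le (Nat.le_floor ?_)
        rw [le_div_iff₀ hτpos]
        have h1 : (h0 + q * m) / B = h0 / B := by
          rw [← hh0.2] at hh; exact (Prod.mk.inj hh.2).1
        have h2 : q * m < B := by
          have e1 := Nat.div_add_mod (h0 + q * m) B
          have e2 := Nat.div_add_mod h0 B
          have e3 := Nat.mod_lt (h0 + q * m) (by omega : 0 < B)
          rw [h1] at e1
          omega
        have h3 : (q : ℝ) * m ≤ B := by exact_mod_cast h2.le
        have h4 : (m : ℝ) * τ ≤ 1 / 2 := by
          have h5 : (q : ℝ) * m ≤ q / (2 * τ) := h3.trans hBτ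
          rw [le_div_iff₀ (by positivity)] at h5
          nlinarith
        have h6 := hdiff _ hh.1 _ hh0.1
        obtain ⟨a, s, hs1, hs2⟩ := exists_eq_add_nearestIntDist (q * α)
        have h7 : α * ((h0 + q * m : ℕ) : ℝ) - α * h0 = ((a * m : ℤ) : ℝ) + m * s := by
          push_cast
          linear_combination (m : ℝ) * hs1
        have h8 : |(m : ℝ) * s| = m * τ := by
          rw [abs_mul, hs2, Nat.abs_cast]
        rw [← h8, ← nearestIntDist_eq_abs (by rw [h8]; exact h4)]
        have h9 : (m : ℝ) * s = α * ((h0 + q * m : ℕ) : ℝ) - α * h0 - ((a * m : ℤ) : ℝ) := by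
          rw [h7]; ring
        rw [h9]
        refine (nearestIntDist_sub_le _ _).trans ?_
        rw [nearestIntDist_intCast, add_zero]
        exact h6
      · intro h hh h' hh' heq
        simp only [coe_filter, Set.mem_ofPred_eq] at hh hh'
        obtain ⟨m, rfl⟩ := hdiv h hh
        obtain ⟨m', rfl⟩ := hdiv h' hh'
        simp only [Nat.add_sub_cancel_left] at heq
        rw [Nat.mul_div_cancel_left _ (by omega), Nat.mul_div_cancel_left _ (by omega)] at heq
        rw [heq]
    have h1 := card_le_mul_card_image S _ hfib
    have h2 : (S.image (fun h => (h / B, h % q))).card ≤ (N / B + 1) * q := by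
      have : S.image (fun h => (h / B, h % q)) ⊆ range (N / B + 1) ×ˢ range q := by
        intro b hb
        obtain ⟨h, hh, rfl⟩ := mem_image.mp hb
        simp only [mem_product, mem_range]
        exact ⟨Nat.lt_succ_of_le (Nat.div_le_div_right (hS h hh).le), Nat.mod_lt _ (by omega)⟩
      simpa using card_le_card this
    have hB0 : (0 : ℝ) < B := by exact_mod_cast hB1
    have h3 : (S.card : ℝ) ≤ (⌊2 * ε / τ⌋₊ + 1) * ((N / B + 1) * q) := by
      have : (S.card : ℝ) ≤ ((⌊2 * ε / τ⌋₊ + 1 : ℕ) : ℝ) * (((N / B + 1) * q : ℕ) : ℝ) := by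
        exact_mod_cast h1.trans (Nat.mul_le_mul_left _ h2)
      refine this.trans ?_
      push_cast
      gcongr
      exact Nat.cast_div_le
    have h4 : (⌊2 * ε / τ⌋₊ : ℝ) + 1 ≤ 4 * ε / τ := by
      have e1 : (⌊2 * ε / τ⌋₊ : ℝ) ≤ 2 * ε / τ := Nat.floor_le (by positivity)
      have e2 : 1 ≤ 2 * ε / τ := by rw [le_div_iff₀ hτpos]; linarith
      have e3 : 4 * ε / τ = 2 * ε / τ + 2 * ε / τ := by ring
      linarith
    have h5 : (N : ℝ) / B + 1 ≤ 2 * (N / B) := by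
      have : (1 : ℝ) ≤ N / B := by
        rw [le_div_iff₀ hB0]; simpa using (by exact_mod_cast hBN : (B : ℝ) ≤ N)
      linarith
    have h6 : (N : ℝ) / R ≤ (4 * ε / τ) * ((2 * (N / B)) * q) := by
      refine hcard.trans (h3.trans ?_)
      gcongr
    rw [div_le_iff₀ hR0] at h6
    have h7 : 4 * ε / τ * (2 * (N / B) * q) * R = N * (8 * R * q * ε) / (B * τ) := by
      field_simp; ring
    rw [h7, le_div_iff₀ (by positivity)] at h6
    exact le_of_mul_le_mul_left h6 hN0
  have hqτ : 1 ≤ (q : ℝ) / (2 * τ) := by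
    rw [le_div_iff₀ (by positivity)]; linarith
  rcases le_total (N : ℝ) (q / (2 * τ)) with hc | hc
  · have := key N (by exact_mod_cast (by linarith : (1 : ℝ) ≤ N)) le_rfl hc
    calc τ * N = N * τ := mul_comm _ _
      _ ≤ 8 * R * q * ε := this
      _ ≤ 8 * R * (2 * R) * ε := by gcongr
      _ = 16 * R ^ 2 * ε := by ring
  · exfalso
    have hfl : 1 ≤ ⌊(q : ℝ) / (2 * τ)⌋₊ := Nat.le_floor (by simpa using hqτ)
    have hfl2 : (⌊(q : ℝ) / (2 * τ)⌋₊ : ℝ) ≤ q / (2 * τ) := Nat.floor_le (by positivity)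
    have h1 := key _ hfl (by exact_mod_cast hfl2.trans hc) hfl2
    have h2 : (q : ℝ) / (2 * τ) < ⌊(q : ℝ) / (2 * τ)⌋₊ + 1 := Nat.lt_floor_add_one _
    have h3 : (1 : ℝ) ≤ ⌊(q : ℝ) / (2 * τ)⌋₊ := by exact_mod_cast hfl
    have h4 : (q : ℝ) / (2 * τ) < 2 * ⌊(q : ℝ) / (2 * τ)⌋₊ := by linarith
    rw [div_lt_iff₀ (by positivity)] at h4
    rw [lt_div_iff₀ (by positivity)] at hε
    nlinarith

/-! ### Exponential sums -/

/-- The additive character `x ↦ exp (2πix)`. -/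
noncomputable def unitExp (x : ℝ) : ℂ := Complex.exp (Complex.I * ((2 * Real.pi * x : ℝ) : ℂ))

lemma unitExp_add (x y : ℝ) : unitExp (x + y) = unitExp x * unitExp y := by
  rw [unitExp, unitExp, unitExp, ← Complex.exp_add]
  congr 1
  push_cast
  ring

@[simp] lemma unitExp_zero : unitExp 0 = 1 := by simp [unitExp]

@[simp] lemma norm_unitExp (x : ℝ) : ‖unitExp x‖ = 1 := by
  rw [unitExp, mul_comm, Complex.norm_exp_ofReal_mul_I]

lemma unitExp_intCast (m : ℤ) : unitExp m = 1 := by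
  rw [unitExp, Complex.exp_eq_one_iff]
  exact ⟨m, by push_cast; ring⟩

lemma conj_unitExp (x : ℝ) : (starRingEnd ℂ) (unitExp x) = unitExp (-x) := by
  rw [unitExp, unitExp, ← Complex.exp_conj]
  congr 1
  rw [map_mul, Complex.conj_I, Complex.conj_ofReal]
  push_cast
  ring

lemma unitExp_nat_mul (n : ℕ) (x : ℝ) : unitExp (n * x) = unitExp x ^ n := by
  induction n with
  | zero => simp
  | succ n ih => rw [pow_succ, ← ih, ← unitExp_add]; congr 1; push_cast; ring

lemma norm_unitExp_sub_one_le (x : ℝ) : ‖unitExp x - 1‖ ≤ 7 * nearestIntDist x := by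
  obtain ⟨m, s, h1, h2⟩ := exists_eq_add_nearestIntDist x
  rw [← h2, h1, unitExp_add, unitExp_intCast, one_mul, unitExp]
  refine (Real.norm_exp_I_mul_ofReal_sub_one_le).trans ?_
  rw [Real.norm_eq_abs, abs_mul, abs_of_pos (by positivity)]
  gcongr
  linarith [Real.pi_lt_d2]

lemma norm_unitExp_sub_le (x y : ℝ) : ‖unitExp x - unitExp y‖ ≤ 7 * nearestIntDist (x - y) := by
  have : unitExp x - unitExp y = unitExp y * (unitExp (x - y) - 1) := by
    rw [mul_sub, ← unitExp_add]; simp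
  rw [this, norm_mul, norm_unitExp, one_mul]
  exact norm_unitExp_sub_one_le _

lemma four_mul_nearestIntDist_le (x : ℝ) : 4 * nearestIntDist x ≤ ‖unitExp x - 1‖ := by
  obtain ⟨m, s, h1, h2⟩ := exists_eq_add_nearestIntDist x
  have hs : |s| ≤ 1 / 2 := h2 ▸ nearestIntDist_le_half x
  rw [← h2, h1, unitExp_add, unitExp_intCast, one_mul, unitExp,
    Complex.norm_exp_I_mul_ofReal_sub_one, Real.norm_eq_abs, abs_mul, abs_two]
  have h3 : 2 * |s| ≤ |Real.sin (2 * Real.pi * s / 2)| := by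
    have h4 : |Real.sin (2 * Real.pi * s / 2)| = |Real.sin (Real.pi * |s|)| := by
      rcases abs_cases s with ⟨h, -⟩ | ⟨h, -⟩ <;> rw [h]
      · congr 2; ring
      · rw [mul_neg, Real.sin_neg, abs_neg]; congr 2; ring
    rw [h4]
    refine le_trans ?_ (le_abs_self _)
    have := Real.mul_le_sin (x := Real.pi * |s|) (by positivity)
      (by nlinarith [Real.pi_pos])
    refine le_trans (le_of_eq ?_) this
    field_simp
  linarith

/-- A long sum that is large contains a long block whose sum is large. -/
lemma exists_large_block {z : ℕ → ℂ} (hz : ∀ n, ‖z n‖ ≤ 1) {R : ℝ} (hR : 2 ≤ R) {N N₁ H : ℕ}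
    (hH : 1 ≤ H) (hsum : N / R ≤ ‖∑ n ∈ range N, z n‖) (hNH : 4 * R * (N₁ + H) ≤ N) :
    ∃ n₀, N₁ ≤ n₀ ∧ n₀ + H ≤ N ∧ H / (2 * R) ≤ ‖∑ h ∈ range H, z (n₀ + h)‖ := by
  by_contra! hcon
  have hR0 : 0 < R := by linarith
  have hH0 : (1 : ℝ) ≤ H := by exact_mod_cast hH
  have hN₁N : N₁ ≤ N := by
    have : (N₁ : ℝ) ≤ N := by
      have : (0 : ℝ) ≤ N₁ := by positivity
      nlinarith
    exact_mod_cast this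
  have hnorm : ∀ s : Finset ℕ, ∀ g : ℕ → ℕ, ‖∑ n ∈ s, z (g n)‖ ≤ s.card := fun s g => by
    simpa using norm_sum_le_of_le s (fun n _ => hz (g n))
  have hind : ∀ i : ℕ, N₁ + i * H ≤ N →
      ‖∑ n ∈ range (N₁ + i * H), z n‖ ≤ N₁ + i * (H / (2 * R)) := by
    intro i
    induction i with
    | zero => intro _; simpa using hnorm (range N₁) id
    | succ i ih =>
      intro hi
      have e : N₁ + (i + 1) * H = N₁ + i * H + H := by ring
      rw [e, sum_range_add]
      refine (norm_add_le _ _).trans ?_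
      have h1 := ih (by rw [e] at hi; omega)
      have h2 := hcon (N₁ + i * H) (by omega) (by rw [← e]; exact hi)
      push_cast
      linarith
  set j := (N - N₁) / H with hj
  have h1 := Nat.div_add_mod (N - N₁) H
  have h2 := Nat.mod_lt (N - N₁) (by omega : 0 < H)
  rw [← hj, mul_comm] at h1
  have h3 := hind j (by omega)
  have h4 : N = N₁ + j * H + (N - N₁) % H := by omega
  have h5 : ‖∑ n ∈ range N, z n‖ ≤ N₁ + j * (H / (2 * R)) + H := by
    rw [h4, sum_range_add]
    refine (norm_add_le _ _).trans (add_le_add h3 ?_)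
    refine (hnorm (range ((N - N₁) % H)) (fun n => N₁ + j * H + n)).trans ?_
    rw [card_range]
    exact_mod_cast h2.le
  have h6 : (j : ℝ) * (H / (2 * R)) ≤ N / R / 2 := by
    have : (j : ℝ) * H ≤ N := by exact_mod_cast (by omega : j * H ≤ N)
    calc (j : ℝ) * (H / (2 * R)) = j * H / (2 * R) := by ring
      _ ≤ N / (2 * R) := by gcongr
      _ = N / R / 2 := by field_simp
  have h7 : (N₁ : ℝ) + H ≤ N / R / 4 := by
    rw [div_div, le_div_iff₀ (by positivity)]
    linarith
  have : (0 : ℝ) < N / R := by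
    have : (0 : ℝ) ≤ N₁ := by positivity
    linarith
  linarith

/-- Version of `exists_large_block` for arithmetic progressions of difference `q`. -/
lemma exists_large_progression {z : ℕ → ℂ} (hz : ∀ n, ‖z n‖ ≤ 1) {R : ℝ} (hR : 2 ≤ R)
    {N q M : ℕ} (hq : 1 ≤ q) (hM : 1 ≤ M) (hsum : N / R ≤ ‖∑ n ∈ range N, z n‖)
    (hNM : 4 * R * (q * M) ≤ N) :
    ∃ n₀, n₀ + q * (M - 1) < N ∧ M / (2 * R) ≤ ‖∑ m ∈ range M, z (n₀ + q * m)‖ := by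
  obtain ⟨n₀, -, h1, h2⟩ := exists_large_block (N₁ := 0) (H := q * M) hz hR
    (Nat.mul_pos hq hM) hsum (by push_cast; linarith)
  have hq0 : (0 : ℝ) < q := by exact_mod_cast hq
  have hsplit : ∑ h ∈ range (q * M), z (n₀ + h) =
      ∑ a ∈ range q, ∑ m ∈ range M, z (n₀ + a + q * m) := by
    rw [sum_comm]
    clear h1 h2 hsum hNM hM
    induction M with
    | zero => simp
    | succ M ih =>
      rw [Nat.mul_succ, sum_range_add, sum_range_succ, ih]
      congr 1
      exact sum_congr rfl fun a _ => by congr 1; ring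
  rw [hsplit] at h2
  obtain ⟨a, ha, h3⟩ : ∃ a ∈ range q, M / (2 * R) ≤ ‖∑ m ∈ range M, z (n₀ + a + q * m)‖ := by
    by_contra! hcon
    have h4 := norm_sum_le (range q) (fun a => ∑ m ∈ range M, z (n₀ + a + q * m))
    have h5 := sum_lt_sum_of_nonempty (by simpa using (by omega : q ≠ 0)) hcon
    rw [sum_const, card_range, nsmul_eq_mul] at h5
    have h6 : (q : ℝ) * (M / (2 * R)) = ((q * M : ℕ) : ℝ) / (2 * R) := by push_cast; ring
    linarith
  refine ⟨n₀ + a, ?_, h3⟩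
  obtain ⟨M, rfl⟩ : ∃ M', M = M' + 1 := ⟨M - 1, by omega⟩
  rw [mem_range] at ha
  rw [Nat.mul_succ] at h1
  simp only [Nat.add_sub_cancel]
  omega

/-- Weyl differencing. -/
lemma norm_sum_sq_le (z : ℕ → ℂ) (N : ℕ) :
    ‖∑ n ∈ range N, z n‖ ^ 2 ≤
      2 * ∑ h ∈ range N, ‖∑ n ∈ range (N - h), z (n + h) * (starRingEnd ℂ) (z n)‖ := by
  set T : ℕ → ℂ := fun N =>
    ∑ h ∈ range N, ∑ n ∈ range (N - h), z (n + h) * (starRingEnd ℂ) (z n) with hT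
  have hTs : ∀ N, T (N + 1) = T N + z N * (starRingEnd ℂ) (∑ n ∈ range (N + 1), z n) := by
    intro N
    have h1 : T (N + 1) = ∑ h ∈ range (N + 1),
        (∑ n ∈ range (N - h), z (n + h) * (starRingEnd ℂ) (z n) +
          z N * (starRingEnd ℂ) (z (N - h))) := by
      refine sum_congr rfl fun h hh => ?_
      rw [mem_range] at hh
      rw [show N + 1 - h = N - h + 1 by omega, sum_range_succ, show N - h + h = N by omega]
    rw [h1, sum_add_distrib, sum_range_succ, Nat.sub_self, range_zero, sum_empty, add_zero,
      map_sum, mul_sum]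
    congr 1
    exact sum_range_reflect (fun n => z N * (starRingEnd ℂ) (z n)) (N + 1)
  have hid : ∀ N, ‖∑ n ∈ range N, z n‖ ^ 2 + ∑ n ∈ range N, ‖z n‖ ^ 2 = 2 * (T N).re := by
    intro N
    induction N with
    | zero => simp [hT]
    | succ N ih =>
      rw [hTs, Complex.add_re, mul_add, ← ih, sum_range_succ, sum_range_succ]
      simp only [← Complex.normSq_eq_norm_sq, Complex.normSq_apply, map_add, Complex.add_re,
        Complex.add_im, Complex.mul_re, Complex.conj_re, Complex.conj_im]
      ring
  have h1 := hid N
  have h2 : (T N).re ≤ ‖T N‖ := Complex.re_le_norm _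
  have h3 : ‖T N‖ ≤ ∑ h ∈ range N, ‖∑ n ∈ range (N - h), z (n + h) * (starRingEnd ℂ) (z n)‖ :=
    norm_sum_le _ _
  have h4 : 0 ≤ ∑ n ∈ range N, ‖z n‖ ^ 2 := sum_nonneg fun _ _ => by positivity
  linarith

lemma card_large_differences {z : ℕ → ℂ} (hz : ∀ n, ‖z n‖ ≤ 1) {R : ℝ} (hR : 2 ≤ R) {N : ℕ}
    (hN : 1 ≤ N) (hsum : N / R ≤ ‖∑ n ∈ range N, z n‖) :
    N / R ^ 4 ≤ (((range N).filter fun h => N / R ^ 4 ≤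
      ‖∑ n ∈ range (N - h), z (n + h) * (starRingEnd ℂ) (z n)‖).card : ℝ) := by
  have hN0 : (1 : ℝ) ≤ N := by exact_mod_cast hN
  have hR0 : 0 < R := by linarith
  set g : ℕ → ℝ := fun h => ‖∑ n ∈ range (N - h), z (n + h) * (starRingEnd ℂ) (z n)‖ with hg
  have hgN : ∀ h, g h ≤ N := by
    intro h
    have : g h ≤ (N - h : ℕ) := by
      have := norm_sum_le_of_le (range (N - h)) (f := fun n => z (n + h) * (starRingEnd ℂ) (z n))
        (n := fun _ => (1 : ℝ)) (fun n _ => by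
          rw [norm_mul, RCLike.norm_conj]
          exact mul_le_one₀ (hz _) (norm_nonneg _) (hz _))
      simpa using this
    exact this.trans (by exact_mod_cast Nat.sub_le _ _)
  have h1 : (N / R) ^ 2 ≤ 2 * ∑ h ∈ range N, g h :=
    (by gcongr : (N / R) ^ 2 ≤ _).trans (norm_sum_sq_le z N)
  set S := (range N).filter fun h => N / R ^ 4 ≤ g h with hS
  have h2 : ∑ h ∈ range N, g h ≤ S.card * N + N * (N / R ^ 4) := by
    rw [← sum_filter_add_sum_filter_not (range N) (fun h => N / R ^ 4 ≤ g h)]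
    refine add_le_add ?_ ?_
    · simpa using sum_le_card_nsmul S g N (fun h _ => hgN h)
    · have := sum_le_card_nsmul ((range N).filter fun h => ¬ N / R ^ 4 ≤ g h) g (N / R ^ 4)
        (fun h hh => (not_le.mp (mem_filter.mp hh).2).le)
      refine this.trans ?_
      rw [nsmul_eq_mul]
      gcongr
      exact (card_filter_le _ _).trans (card_range N).le
  have h3 : (N / R) ^ 2 = N * (R ^ 2 * (N / R ^ 4)) := by field_simp
  rw [h3] at h1
  have h4 : (0 : ℝ) ≤ N / R ^ 4 := by positivity
  have h5 : 4 * (N / R ^ 4) ≤ R ^ 2 * (N / R ^ 4) := by gcongr; nlinarith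
  have h6 : (N : ℝ) * (4 * (N / R ^ 4)) ≤ N * (2 * (S.card + N / R ^ 4)) := by
    have : (N : ℝ) * (4 * (N / R ^ 4)) ≤ N * (R ^ 2 * (N / R ^ 4)) := by gcongr
    nlinarith
  have h7 := le_of_mul_le_mul_left h6 (by linarith)
  linarith

/-! ### Weyl's inequality in inverse form -/

lemma coeff_taylor_eq_sum {P : ℝ[X]} {K : ℕ} (hP : P.natDegree ≤ K) (r : ℝ) (i : ℕ) :
    (taylor r P).coeff i = ∑ d ∈ range (K + 1), P.coeff d * (d.choose i) * r ^ (d - i) := by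
  rw [taylor_coeff, hasseDeriv_apply, sum_over_range' _ (by simp) (K + 1) (by omega),
    eval_finsetSum]
  refine sum_congr rfl fun d _ => ?_
  rw [eval_monomial]
  ring

/-- Rational approximations to the coefficients of `P (n₀ + Q X)` give rational approximations to
the coefficients of `P`. -/
lemma nearestIntDist_coeff_le {P : ℝ[X]} {K : ℕ} (hP : P.natDegree ≤ K) {Q n₀ N q : ℕ}
    (hQ : 1 ≤ Q) (hn₀ : n₀ ≤ N) {B : ℝ} (hB : 0 ≤ B)
    (h : ∀ d, 1 ≤ d → d ≤ K →
      nearestIntDist (q * ((taylor (n₀ : ℝ) P).comp (C (Q : ℝ) * X)).coeff d) * (N : ℝ) ^ d ≤ B)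
    {i : ℕ} (hi : 1 ≤ i) :
    nearestIntDist (((q * Q ^ K : ℕ) : ℝ) * P.coeff i) * (N : ℝ) ^ i ≤
      (K + 1) * (2 ^ K * Q ^ K * B) := by
  have hQ0 : (1 : ℝ) ≤ Q := by exact_mod_cast hQ
  set T := (taylor (n₀ : ℝ) P).comp (C (Q : ℝ) * X) with hT
  have hTd : ∀ d, T.coeff d = (taylor (n₀ : ℝ) P).coeff d * (Q : ℝ) ^ d := fun d => by
    rw [hT, comp_C_mul_X_coeff]
  have h1 : P.coeff i = ∑ d ∈ range (K + 1),
      (taylor (n₀ : ℝ) P).coeff d * (d.choose i) * (-(n₀ : ℝ)) ^ (d - i) := by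
    rw [← coeff_taylor_eq_sum (by rwa [natDegree_taylor]) (-(n₀ : ℝ)) i, taylor_taylor]
    simp
  have h2 : ((q * Q ^ K : ℕ) : ℝ) * P.coeff i = ∑ d ∈ range (K + 1),
      (((d.choose i : ℤ) * (-(n₀ : ℤ)) ^ (d - i) * (Q : ℤ) ^ (K - d) : ℤ) : ℝ) *
        (q * T.coeff d) := by
    rw [h1, mul_sum]
    refine sum_congr rfl fun d hd => ?_
    rw [mem_range] at hd
    have : (Q : ℝ) ^ K = (Q : ℝ) ^ (K - d) * (Q : ℝ) ^ d := by
      rw [← pow_add]; congr 1; omega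
    rw [hTd]
    push_cast
    rw [this]
    ring
  rw [h2]
  have h3 := nearestIntDist_sum_le (range (K + 1)) (fun d =>
      (((d.choose i : ℤ) * (-(n₀ : ℤ)) ^ (d - i) * (Q : ℤ) ^ (K - d) : ℤ) : ℝ) *
        (q * T.coeff d))
  calc _ ≤ (∑ d ∈ range (K + 1), _) * (N : ℝ) ^ i := by gcongr
    _ ≤ ∑ d ∈ range (K + 1), 2 ^ K * Q ^ K * B := by
      rw [sum_mul]
      refine sum_le_sum fun d hd => ?_
      rw [mem_range] at hd
      rcases lt_or_ge d i with hdi | hdi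
      · rw [Nat.choose_eq_zero_of_lt hdi]
        simp only [Nat.cast_zero, zero_mul, Int.cast_zero]
        rw [show nearestIntDist 0 = 0 by simpa using nearestIntDist_intCast 0, zero_mul]
        positivity
      · refine (mul_le_mul_of_nonneg_right (nearestIntDist_int_mul_le _ _) (by positivity)).trans ?_
        have e1 : |(((d.choose i : ℤ) * (-(n₀ : ℤ)) ^ (d - i) * (Q : ℤ) ^ (K - d) : ℤ) : ℝ)| =
            (d.choose i) * (n₀ : ℝ) ^ (d - i) * (Q : ℝ) ^ (K - d) := by
          push_cast
          rw [abs_mul, abs_mul, abs_pow, abs_neg, abs_pow]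
          simp
        rw [e1]
        have e2 : (N : ℝ) ^ d = (N : ℝ) ^ (d - i) * (N : ℝ) ^ i := by
          rw [← pow_add]; congr 1; omega
        have e3 := h d (by omega) (by omega)
        rw [e2] at e3
        have e4 : (d.choose i : ℝ) ≤ 2 ^ K := by
          have : d.choose i ≤ 2 ^ K := (Nat.choose_le_two_pow d i).trans
            (Nat.pow_le_pow_right (by norm_num) (by omega))
          exact_mod_cast this
        have e5 : (Q : ℝ) ^ (K - d) ≤ (Q : ℝ) ^ K := pow_le_pow_right₀ hQ0 (by omega)
        have e6 : (n₀ : ℝ) ≤ N := by exact_mod_cast hn₀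
        have e7 := nearestIntDist_nonneg (q * T.coeff d)
        calc _ ≤ 2 ^ K * (N : ℝ) ^ (d - i) * (Q : ℝ) ^ K * nearestIntDist (q * T.coeff d) *
              (N : ℝ) ^ i := by gcongr
          _ = 2 ^ K * (Q : ℝ) ^ K * (nearestIntDist (q * T.coeff d) *
              ((N : ℝ) ^ (d - i) * (N : ℝ) ^ i)) := by ring
          _ ≤ _ := by gcongr
    _ = _ := by simp

/-- The inverse form of Weyl's inequality for polynomials of degree at most `K`. -/
def WeylInverse (K : ℕ) : Prop :=
  ∃ A : ℕ, ∀ R : ℝ, 2 ≤ R → ∀ N : ℕ, 1 ≤ N → ∀ P : ℝ[X], P.natDegree ≤ K →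
    N / R ≤ ‖∑ n ∈ range N, unitExp (P.eval (n : ℝ))‖ →
    ∃ q : ℕ, 1 ≤ q ∧ (q : ℝ) ≤ R ^ A ∧
      ∀ i, 1 ≤ i → i ≤ K → nearestIntDist (q * P.coeff i) * (N : ℝ) ^ i ≤ R ^ A

lemma weylInverse_one : WeylInverse 1 := by
  refine ⟨1, fun R hR N hN P hP hsum => ⟨1, le_rfl, by simp; linarith, fun i hi hi1 => ?_⟩⟩
  obtain rfl : i = 1 := by omega
  have hR0 : 0 < R := by linarith
  have h1 : ∀ n : ℕ, unitExp (P.eval (n : ℝ)) = unitExp (P.coeff 0) * unitExp (P.coeff 1) ^ n := by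
    intro n
    rw [← unitExp_nat_mul, ← unitExp_add]
    congr 1
    conv_lhs => rw [eq_X_add_C_of_natDegree_le_one hP]
    simp
    ring
  simp_rw [h1] at hsum
  rw [← mul_sum, norm_mul, norm_unitExp, one_mul] at hsum
  have h2 := mul_geom_sum (unitExp (P.coeff 1)) N
  have h3 : ‖unitExp (P.coeff 1) - 1‖ * ‖∑ n ∈ range N, unitExp (P.coeff 1) ^ n‖ ≤ 2 := by
    rw [← norm_mul, h2]
    refine (norm_sub_le _ _).trans ?_
    rw [norm_pow, norm_unitExp]
    norm_num
  have h4 := four_mul_nearestIntDist_le (P.coeff 1)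
  have h5 := nearestIntDist_nonneg (P.coeff 1)
  have h6 : 4 * nearestIntDist (P.coeff 1) * (N / R) ≤ 2 := le_trans (by gcongr) h3
  have h7 : 4 * nearestIntDist (P.coeff 1) * (N / R) = 4 * (nearestIntDist (P.coeff 1) * N) / R := by
    ring
  rw [h7, div_le_iff₀ hR0] at h6
  simp
  linarith

lemma natCast_le_pow {R : ℝ} (hR : 2 ≤ R) (n : ℕ) : (n : ℝ) ≤ R ^ n :=
  calc (n : ℝ) ≤ 2 ^ n := by exact_mod_cast (Nat.lt_two_pow_self).le
    _ ≤ R ^ n := by gcongr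

lemma trivial_bound {R : ℝ} (hR : 2 ≤ R) {N A₀ A i K : ℕ} (hN : (N : ℝ) ≤ R ^ A₀) (hi : i ≤ K)
    (hA : A₀ * K ≤ A) (x : ℝ) : nearestIntDist x * (N : ℝ) ^ i ≤ R ^ A := by
  have h1 : (1 : ℝ) ≤ R ^ A₀ := one_le_pow₀ (by linarith)
  calc nearestIntDist x * (N : ℝ) ^ i ≤ 1 * (R ^ A₀) ^ i := by
        gcongr; linarith [nearestIntDist_le_half x]
    _ ≤ 1 * (R ^ A₀) ^ K := by gcongr
    _ = R ^ (A₀ * K) := by rw [one_mul, pow_mul]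
    _ ≤ R ^ A := pow_le_pow_right₀ (by linarith) hA

lemma WeylInverse.leadingCoeff {K : ℕ} (hK : 1 ≤ K) (hW : WeylInverse K) :
    ∃ A : ℕ, ∀ R : ℝ, 2 ≤ R → ∀ N : ℕ, 1 ≤ N → ∀ P : ℝ[X], P.natDegree ≤ K + 1 →
      N / R ≤ ‖∑ n ∈ range N, unitExp (P.eval (n : ℝ))‖ →
      ∃ q : ℕ, 1 ≤ q ∧ (q : ℝ) ≤ R ^ A ∧
        nearestIntDist (q * P.coeff (K + 1)) * (N : ℝ) ^ (K + 1) ≤ R ^ A := by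
  obtain ⟨A, hA⟩ := hW
  set A₀ := 8 * A + 4 * K + 9 with hA₀
  refine ⟨A₀ * (K + 1) + (12 * A + 5 * K + 20), fun R hR N hN P hP hsum => ?_⟩
  have hR1 : 1 ≤ R := by linarith
  have hR0 : 0 < R := by linarith
  have hN1 : (1 : ℝ) ≤ N := by exact_mod_cast hN
  have hN0 : (0 : ℝ) < N := by linarith
  rcases le_or_gt (N : ℝ) (R ^ A₀) with hsmall | hbig
  · exact ⟨1, le_rfl, by simpa using one_le_pow₀ hR1,
      trivial_bound hR hsmall le_rfl (by omega) _⟩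
  set p := P.coeff (K + 1) with hp
  have htay : ∀ (h : ℝ) (n : ℕ), K + 1 ≤ n → (taylor h P - P).coeff n = 0 := by
    intro h n hn
    rw [coeff_sub, coeff_taylor_eq_sum hP, sum_range_succ, sum_eq_zero]
    · rcases hn.eq_or_lt with rfl | hn
      · simp
      · rw [Nat.choose_eq_zero_of_lt hn, coeff_eq_zero_of_natDegree_lt (n := n) (by omega)]
        simp
    · intro d hd
      rw [Nat.choose_eq_zero_of_lt (by rw [mem_range] at hd; omega)]
      simp
  have htayK : ∀ h : ℝ, (taylor h P - P).coeff K = (K + 1) * p * h := by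
    intro h
    rw [coeff_sub, coeff_taylor_eq_sum hP, sum_range_succ, sum_range_succ, sum_eq_zero]
    · rw [Nat.choose_self, Nat.choose_succ_self_right, Nat.sub_self, Nat.add_sub_cancel_left, hp]
      push_cast
      ring
    · intro d hd
      rw [Nat.choose_eq_zero_of_lt (by rw [mem_range] at hd; omega)]
      simp
  set z : ℕ → ℂ := fun n => unitExp (P.eval (n : ℝ)) with hz
  set S := (range N).filter fun h => N / R ^ 4 ≤
      ‖∑ n ∈ range (N - h), z (n + h) * (starRingEnd ℂ) (z n)‖ with hS
  have hScard : N / R ^ 4 ≤ (S.card : ℝ) :=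
    card_large_differences (fun n => by simp [hz]) hR hN hsum
  have hex : ∀ h ∈ S, ∃ q : ℕ, 1 ≤ q ∧ (q : ℝ) ≤ R ^ (4 * A) ∧
      nearestIntDist (q * ((K + 1) * p * h)) ≤ R ^ (4 * A + 4 * K) / N ^ K := by
    intro h hh
    rw [hS, mem_filter, mem_range] at hh
    have e1 : ∀ n : ℕ, z (n + h) * (starRingEnd ℂ) (z n) =
        unitExp ((taylor (h : ℝ) P - P).eval (n : ℝ)) := by
      intro n
      rw [hz]
      simp only
      rw [conj_unitExp, ← unitExp_add, eval_sub, taylor_eval]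
      push_cast
      rw [sub_eq_add_neg]
    have e2 := hh.2
    simp_rw [e1] at e2
    have e3 : ((N - h : ℕ) : ℝ) ≤ N := by exact_mod_cast Nat.sub_le _ _
    have e4 : (N : ℝ) / R ^ 4 ≤ (N - h : ℕ) := by
      refine e2.trans ((norm_sum_le _ _).trans ?_)
      simp
    obtain ⟨q, hq1, hq2, hq3⟩ := hA (R ^ 4) (hR.trans (le_self_pow₀ hR1 (by norm_num)))
      (N - h) (by omega) (taylor (h : ℝ) P - P)
      (natDegree_le_iff_coeff_eq_zero.mpr fun n hn => htay _ _ hn)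
      (le_trans (by gcongr) e2)
    refine ⟨q, hq1, by rwa [pow_mul], ?_⟩
    have e5 := hq3 K hK le_rfl
    rw [htayK] at e5
    rw [le_div_iff₀ (by positivity)]
    have e6 : (N : ℝ) ^ K ≤ R ^ (4 * K) * ((N - h : ℕ) : ℝ) ^ K := by
      rw [pow_mul, ← mul_pow]
      gcongr
      rwa [div_le_iff₀' (by positivity)] at e4
    calc _ ≤ nearestIntDist (q * ((K + 1) * p * h)) *
          (R ^ (4 * K) * ((N - h : ℕ) : ℝ) ^ K) := by
          gcongr; exact nearestIntDist_nonneg _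
      _ = nearestIntDist (q * ((K + 1) * p * h)) * ((N - h : ℕ) : ℝ) ^ K * R ^ (4 * K) := by ring
      _ ≤ (R ^ 4) ^ A * R ^ (4 * K) := by gcongr
      _ = _ := by rw [← pow_mul, ← pow_add]
  choose! qf hqf1 hqf2 hqf3 using hex
  obtain ⟨q, hq, hcard⟩ : ∃ q ∈ Icc 1 ⌊R ^ (4 * A)⌋₊,
      N / R ^ (4 * A + 4) ≤ ((S.filter fun h => qf h = q).card : ℝ) := by
    apply exists_le_card_fiber_of_nsmul_le_card_of_maps_to
    · intro h hh
      exact mem_Icc.mpr ⟨hqf1 h hh, Nat.le_floor (hqf2 h hh)⟩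
    · rw [nonempty_Icc]
      exact Nat.le_floor (by simpa using one_le_pow₀ hR1)
    · rw [Nat.card_Icc, nsmul_eq_mul, Nat.add_sub_cancel]
      calc _ ≤ R ^ (4 * A) * (N / R ^ (4 * A + 4)) := by
            gcongr; exact Nat.floor_le (by positivity)
        _ = N / R ^ 4 := by rw [pow_add]; field_simp
        _ ≤ _ := hScard
  rw [mem_Icc] at hq
  have hqR : (q : ℝ) ≤ R ^ (4 * A) := (Nat.le_floor_iff (by positivity)).mp hq.2
  set ε := R ^ (4 * A + 4 * K) / (N : ℝ) ^ K with hε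
  have h32 : (32 : ℝ) ≤ R ^ 5 := by
    calc (32 : ℝ) = 2 ^ 5 := by norm_num
      _ ≤ R ^ 5 := by gcongr
  obtain ⟨q', hq'1, hq'2, hq'3⟩ := exists_small_denominator (R := R ^ (4 * A + 4)) (N := N)
    (S := S.filter fun h => qf h = q) (α := q * ((K + 1) * p)) (ε := ε)
    (hR.trans (le_self_pow₀ hR1 (by omega)))
    (by
      calc 4 * R ^ (4 * A + 4) ≤ R ^ 5 * R ^ (4 * A + 4) := by gcongr; linarith
        _ = R ^ (5 + (4 * A + 4)) := by rw [← pow_add]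
        _ ≤ R ^ A₀ := pow_le_pow_right₀ hR1 (by omega)
        _ ≤ N := hbig.le)
    (fun h hh => mem_range.mp (mem_filter.mp (mem_filter.mp hh).1).1) hcard
    (by
      rw [hε, div_lt_div_iff₀ (by positivity) (by positivity)]
      calc R ^ (4 * A + 4 * K) * (32 * R ^ (4 * A + 4))
          ≤ R ^ (4 * A + 4 * K) * (R ^ 5 * R ^ (4 * A + 4)) := by gcongr
        _ = R ^ A₀ := by rw [← pow_add, ← pow_add, hA₀]; congr 1; ring
        _ < N := hbig
        _ ≤ N ^ K := le_self_pow₀ hN1 (by omega)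
        _ = 1 * N ^ K := by ring)
    (fun h hh => by
      rw [mem_filter] at hh
      have := hqf3 h hh.1
      rw [hh.2] at this
      convert this using 2
      ring)
  refine ⟨q' * q * (K + 1), Nat.mul_pos (Nat.mul_pos hq'1 hq.1) (Nat.succ_pos K), ?_, ?_⟩
  · push_cast
    calc (q' : ℝ) * q * (K + 1) ≤ (2 * R ^ (4 * A + 4)) * R ^ (4 * A) * R ^ (K + 1) := by
          gcongr
          exact_mod_cast natCast_le_pow hR (K + 1)
      _ ≤ (R ^ 1 * R ^ (4 * A + 4)) * R ^ (4 * A) * R ^ (K + 1) := by gcongr; simpa using hR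
      _ = R ^ (1 + (4 * A + 4) + 4 * A + (K + 1)) := by simp only [← pow_add]
      _ ≤ _ := pow_le_pow_right₀ hR1 (by nlinarith [Nat.zero_le (A₀ * (K + 1))])
  · have e1 : ((q' * q * (K + 1) : ℕ) : ℝ) * p = q' * (q * ((K + 1) * p)) := by push_cast; ring
    rw [e1]
    calc nearestIntDist (q' * (q * ((K + 1) * p))) * (N : ℝ) ^ (K + 1)
        = nearestIntDist (q' * (q * ((K + 1) * p))) * N * (N : ℝ) ^ K := by ring
      _ ≤ 16 * (R ^ (4 * A + 4)) ^ 2 * ε * (N : ℝ) ^ K := by gcongr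
      _ = 16 * (R ^ (4 * A + 4)) ^ 2 * R ^ (4 * A + 4 * K) := by rw [hε]; field_simp
      _ ≤ R ^ 5 * (R ^ (4 * A + 4)) ^ 2 * R ^ (4 * A + 4 * K) := by gcongr; linarith
      _ = R ^ (5 + (4 * A + 4) * 2 + (4 * A + 4 * K)) := by
        rw [← pow_mul, ← pow_add, ← pow_add]
      _ ≤ _ := pow_le_pow_right₀ hR1 (by nlinarith [Nat.zero_le (A₀ * (K + 1))])

lemma exists_add_mul_pow_eq (x y N k : ℕ) (hx : x + y ≤ N) :
    ∃ Z : ℕ, (x + y) ^ (k + 1) = x ^ (k + 1) + y * Z ∧ Z ≤ (k + 1) * N ^ k := by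
  refine ⟨∑ i ∈ range (k + 1), (x + y) ^ i * x ^ (k - i), ?_, ?_⟩
  · have h := geom_sum₂_mul ((x + y : ℕ) : ℤ) (x : ℤ) (k + 1)
    have : (((x + y) ^ (k + 1) : ℕ) : ℤ) = ((x ^ (k + 1) + y *
        ∑ i ∈ range (k + 1), (x + y) ^ i * x ^ (k - i) : ℕ) : ℤ) := by
      push_cast
      push_cast [Nat.add_sub_cancel] at h
      linear_combination -h
    exact_mod_cast this
  · refine (sum_le_card_nsmul (range (k + 1)) _ (N ^ k) fun i hi => ?_).trans (by simp)
    rw [mem_range] at hi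
    calc (x + y) ^ i * x ^ (k - i) ≤ N ^ i * N ^ (k - i) := by gcongr; omega
      _ = N ^ k := by rw [← pow_add]; congr 1; omega

lemma WeylInverse.succ {K : ℕ} (hK : 1 ≤ K) (hW : WeylInverse K) : WeylInverse (K + 1) := by
  obtain ⟨At, hAt⟩ := hW.leadingCoeff hK
  obtain ⟨Aw, hAw⟩ := hW
  set A₀ := K + At + 7 with hA₀
  set B := (A₀ + 1) * K + 3 * Aw with hB
  refine ⟨A₀ * (K + 1) + (At + 3 * Aw + K * At + 2 * K + 1 + B), fun R hR N hN P hP hsum => ?_⟩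
  have hR1 : 1 ≤ R := by linarith
  have hR0 : 0 < R := by linarith
  have hN1 : (1 : ℝ) ≤ N := by exact_mod_cast hN
  have hN0 : (0 : ℝ) < N := by linarith
  rcases lt_or_ge (N : ℝ) (R ^ A₀) with hsmall | hbig
  · exact ⟨1, le_rfl, by simpa using one_le_pow₀ hR1, fun i _ hi =>
      trivial_bound hR hsmall.le hi (by omega) _⟩
  obtain ⟨Q, hQ1, hQ2, hQ3⟩ := hAt R hR N hN P hP hsum
  set p := P.coeff (K + 1) with hp
  set P₁ := P.erase (K + 1) with hP₁
  have hP₁deg : P₁.natDegree ≤ K := by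
    rw [natDegree_le_iff_coeff_eq_zero]
    intro n hn
    rw [hP₁, coeff_erase]
    split_ifs with h
    · rfl
    · exact coeff_eq_zero_of_natDegree_lt (by omega)
  have heval : ∀ x : ℝ, P.eval x = p * x ^ (K + 1) + P₁.eval x := by
    intro x
    conv_lhs => rw [← monomial_add_erase P (K + 1)]
    rw [eval_add, eval_monomial]
  set M := ⌊(N : ℝ) / R ^ A₀⌋₊ with hM
  have hM1 : 1 ≤ M := Nat.le_floor (by rw [le_div_iff₀ (by positivity)]; simpa using hbig)
  have hM1' : (1 : ℝ) ≤ M := by exact_mod_cast hM1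
  have hM2 : (M : ℝ) ≤ N / R ^ A₀ := Nat.floor_le (by positivity)
  have hM3 : (N : ℝ) ≤ R ^ (A₀ + 1) * M := by
    have h1 : (N : ℝ) / R ^ A₀ < M + 1 := Nat.lt_floor_add_one _
    rw [div_lt_iff₀ (by positivity)] at h1
    calc (N : ℝ) ≤ (M + 1) * R ^ A₀ := h1.le
      _ ≤ (R * M) * R ^ A₀ := by gcongr; nlinarith
      _ = _ := by ring
  have h2pow : ∀ k : ℕ, (2 : ℝ) ^ k ≤ R ^ k := fun k => by gcongr
  obtain ⟨n₀, hn₀, hblock⟩ := exists_large_progression (z := fun n => unitExp (P.eval (n : ℝ)))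
    (fun n => by simp) hR hQ1 hM1 hsum (by
      calc 4 * R * (Q * M) ≤ R ^ 2 * R * (R ^ At * (N / R ^ A₀)) := by
            gcongr; nlinarith
        _ = R ^ (At + 3) * N / R ^ A₀ := by ring
        _ ≤ N := by
          rw [div_le_iff₀ (by positivity), mul_comm]
          gcongr
          omega)
  have happrox : ∀ m ∈ range M, ‖unitExp (P.eval ((n₀ + Q * m : ℕ) : ℝ)) -
      unitExp (p * n₀ ^ (K + 1)) * unitExp (P₁.eval ((n₀ + Q * m : ℕ) : ℝ))‖ ≤ 1 / (4 * R) := by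
    intro m hm
    rw [mem_range] at hm
    rw [← unitExp_add, heval]
    refine (norm_unitExp_sub_le _ _).trans ?_
    obtain ⟨Z, hZ1, hZ2⟩ := exists_add_mul_pow_eq n₀ (Q * m) N K (by
      have : Q * m ≤ Q * (M - 1) := Nat.mul_le_mul_left _ (by omega)
      omega)
    have e1 : p * ((n₀ + Q * m : ℕ) : ℝ) ^ (K + 1) + P₁.eval ((n₀ + Q * m : ℕ) : ℝ) -
        (p * n₀ ^ (K + 1) + P₁.eval ((n₀ + Q * m : ℕ) : ℝ)) = ((m * Z : ℕ) : ℝ) * (Q * p) := by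
      have : ((n₀ + Q * m : ℕ) : ℝ) ^ (K + 1) = n₀ ^ (K + 1) + Q * m * Z := by exact_mod_cast hZ1
      rw [this]
      push_cast
      ring
    rw [e1]
    have e2 : ((m * Z : ℕ) : ℝ) ≤ M * ((K + 1) * N ^ K) := by
      exact_mod_cast Nat.mul_le_mul hm.le hZ2
    have e3 : nearestIntDist (Q * p) ≤ R ^ At / N ^ (K + 1) := by
      rwa [le_div_iff₀ (by positivity)]
    have e4 : ((K + 1 : ℕ) : ℝ) ≤ R ^ (K + 1) := natCast_le_pow hR _
    push_cast at e4
    calc 7 * nearestIntDist (((m * Z : ℕ) : ℝ) * (Q * p))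
        ≤ 7 * (((m * Z : ℕ) : ℝ) * nearestIntDist (Q * p)) := by
          gcongr; exact nearestIntDist_nat_mul_le _ _
      _ ≤ 7 * ((N / R ^ A₀) * (R ^ (K + 1) * N ^ K) * (R ^ At / N ^ (K + 1))) := by
          gcongr
          · exact nearestIntDist_nonneg _
          · exact e2.trans (by gcongr)
      _ = 7 * (R ^ (K + At + 1) / R ^ A₀) := by field_simp; ring
      _ = 7 / R ^ 6 := by
          rw [hA₀, show K + At + 7 = (K + At + 1) + 6 by ring, pow_add _ _ 6]
          field_simp
      _ ≤ 1 / (4 * R) := by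
          rw [div_le_div_iff₀ (by positivity) (by positivity)]
          have : (2 : ℝ) ^ 5 ≤ R ^ 5 := h2pow 5
          nlinarith
  set T := (taylor (n₀ : ℝ) P₁).comp (C (Q : ℝ) * X) with hT
  have hTdeg : T.natDegree ≤ K := by
    refine natDegree_comp_le.trans ?_
    rw [natDegree_taylor]
    calc _ ≤ K * 1 := Nat.mul_le_mul hP₁deg ((natDegree_C_mul_le _ _).trans natDegree_X_le)
      _ = K := mul_one K
  have hTeval : ∀ m : ℕ, T.eval (m : ℝ) = P₁.eval ((n₀ + Q * m : ℕ) : ℝ) := by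
    intro m
    rw [hT, eval_comp, taylor_eval]
    simp [add_comm]
  have hTsum : M / R ^ 3 ≤ ‖∑ m ∈ range M, unitExp (T.eval (m : ℝ))‖ := by
    simp_rw [hTeval]
    have e1 : ‖∑ m ∈ range M, unitExp (P.eval ((n₀ + Q * m : ℕ) : ℝ)) -
        unitExp (p * n₀ ^ (K + 1)) * ∑ m ∈ range M, unitExp (P₁.eval ((n₀ + Q * m : ℕ) : ℝ))‖ ≤
        M * (1 / (4 * R)) := by
      rw [mul_sum, ← sum_sub_distrib]
      refine (norm_sum_le_of_le _ happrox).trans ?_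
      simp
    have e2 := norm_sub_norm_le (∑ m ∈ range M, unitExp (P.eval ((n₀ + Q * m : ℕ) : ℝ)))
      (unitExp (p * n₀ ^ (K + 1)) * ∑ m ∈ range M, unitExp (P₁.eval ((n₀ + Q * m : ℕ) : ℝ)))
    rw [norm_mul, norm_unitExp, one_mul] at e2
    have e3 : (M : ℝ) / R ^ 3 ≤ M * (1 / (4 * R)) := by
      rw [mul_one_div]
      gcongr
      nlinarith [mul_self_nonneg (R - 2)]
    have e4 : (M : ℝ) / (2 * R) = M * (1 / (4 * R)) + M * (1 / (4 * R)) := by field_simp; ring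
    linarith
  obtain ⟨q, hq1, hq2, hq3⟩ := hAw (R ^ 3) (hR.trans (le_self_pow₀ hR1 (by norm_num))) M hM1 T
    hTdeg hTsum
  rw [← pow_mul] at hq2 hq3
  have hundo : ∀ i, 1 ≤ i → nearestIntDist (((q * Q ^ K : ℕ) : ℝ) * P₁.coeff i) * (N : ℝ) ^ i ≤
      (K + 1) * (2 ^ K * Q ^ K * R ^ B) := by
    intro i hi
    refine nearestIntDist_coeff_le hP₁deg hQ1 (by omega : n₀ ≤ N) (by positivity)
      (fun d hd1 hd2 => ?_) hi
    calc _ ≤ nearestIntDist (q * T.coeff d) * (R ^ (A₀ + 1) * M) ^ d := by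
          gcongr; exact nearestIntDist_nonneg _
      _ = (R ^ (A₀ + 1)) ^ d * (nearestIntDist (q * T.coeff d) * M ^ d) := by ring
      _ ≤ (R ^ (A₀ + 1)) ^ K * R ^ (3 * Aw) := by
          refine mul_le_mul (pow_le_pow_right₀ (one_le_pow₀ hR1) hd2) (hq3 d hd1 hd2) ?_
            (by positivity)
          exact mul_nonneg (nearestIntDist_nonneg _) (by positivity)
      _ = R ^ B := by rw [← pow_mul, ← pow_add]
  have hqQ : (q : ℝ) * Q ^ K ≤ R ^ (3 * Aw + K * At) := by
    calc (q : ℝ) * Q ^ K ≤ R ^ (3 * Aw) * (R ^ At) ^ K := by gcongr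
      _ = R ^ (3 * Aw + K * At) := by rw [← pow_mul, ← pow_add, mul_comm At]
  refine ⟨q * Q ^ K * Q, Nat.mul_pos (Nat.mul_pos hq1 (pow_pos hQ1 K)) hQ1, ?_, ?_⟩
  · push_cast
    calc (q : ℝ) * Q ^ K * Q ≤ R ^ (3 * Aw + K * At) * R ^ At := by gcongr
      _ = R ^ (3 * Aw + K * At + At) := by rw [← pow_add]
      _ ≤ _ := pow_le_pow_right₀ hR1 (by
        generalize A₀ * (K + 1) = a; generalize K * At = b; omega)
  · intro i hi1 hi2
    rcases hi2.eq_or_lt with rfl | hlt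
    · rw [← hp]
      calc nearestIntDist (((q * Q ^ K * Q : ℕ) : ℝ) * p) * (N : ℝ) ^ (K + 1)
          = nearestIntDist (((q * Q ^ K : ℕ) : ℝ) * (Q * p)) * (N : ℝ) ^ (K + 1) := by
            push_cast; ring_nf
        _ ≤ ((q * Q ^ K : ℕ) : ℝ) * nearestIntDist (Q * p) * (N : ℝ) ^ (K + 1) := by
            gcongr; exact nearestIntDist_nat_mul_le _ _
        _ = ((q : ℝ) * Q ^ K) * (nearestIntDist (Q * p) * (N : ℝ) ^ (K + 1)) := by
            push_cast; ring
        _ ≤ R ^ (3 * Aw + K * At) * R ^ At := by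
            gcongr
            exact mul_nonneg (nearestIntDist_nonneg _) (by positivity)
        _ = R ^ (3 * Aw + K * At + At) := by rw [← pow_add]
        _ ≤ _ := pow_le_pow_right₀ hR1 (by
          generalize A₀ * (K + 1) = a; generalize K * At = b; omega)
    · have e1 : P.coeff i = P₁.coeff i := by
        rw [hP₁, coeff_erase, if_neg (by omega)]
      rw [e1]
      calc nearestIntDist (((q * Q ^ K * Q : ℕ) : ℝ) * P₁.coeff i) * (N : ℝ) ^ i
          = nearestIntDist ((Q : ℝ) * (((q * Q ^ K : ℕ) : ℝ) * P₁.coeff i)) * (N : ℝ) ^ i := by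
            push_cast; ring_nf
        _ ≤ Q * nearestIntDist (((q * Q ^ K : ℕ) : ℝ) * P₁.coeff i) * (N : ℝ) ^ i := by
            gcongr; exact nearestIntDist_nat_mul_le _ _
        _ = Q * (nearestIntDist (((q * Q ^ K : ℕ) : ℝ) * P₁.coeff i) * (N : ℝ) ^ i) := by ring
        _ ≤ Q * ((K + 1) * (2 ^ K * Q ^ K * R ^ B)) := mul_le_mul_of_nonneg_left (hundo i hi1) (by positivity)
        _ ≤ R ^ At * (R ^ (K + 1) * (R ^ K * (R ^ At) ^ K * R ^ B)) := by
            gcongr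
            exact_mod_cast natCast_le_pow hR (K + 1)
        _ = R ^ (At + (K + 1 + (K + K * At + B))) := by
            rw [← pow_mul, ← pow_add, ← pow_add, ← pow_add, ← pow_add, mul_comm At]
        _ ≤ _ := pow_le_pow_right₀ hR1 (by
          generalize A₀ * (K + 1) = a; generalize K * At = b; omega)

theorem weylInverse {K : ℕ} (hK : 1 ≤ K) : WeylInverse K := by
  induction K, hK using Nat.le_induction with
  | base => exact weylInverse_one
  | succ K hK ih => exact ih.succ hK

lemma exists_binomial_approx_single (θ : ℝ) (K : ℕ) :
    ∃ M : ℕ, 1 ≤ M ∧ ∀ x : ℝ, 0 ≤ x → x * M ≤ 1 →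
      |(1 + x) ^ θ - ∑ i ∈ range (K + 1), Ring.choose θ i * x ^ i| ≤ M * x ^ (K + 1) := by
  have h := (Real.one_add_rpow_hasFPowerSeriesAt_zero (a := θ)).isBigO_sub_partialSum_pow (K + 1)
  obtain ⟨c, hc⟩ := h.bound
  obtain ⟨ε, hε, hball⟩ := Metric.eventually_nhds_iff.mp hc
  obtain ⟨M, hM⟩ := exists_nat_ge (max (max c (2 / ε)) 1)
  have hM1 : (1 : ℝ) ≤ M := (le_max_right _ _).trans hM
  have hMc : c ≤ M := ((le_max_left _ _).trans (le_max_left _ _)).trans hM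
  have hMε : 2 / ε ≤ M := ((le_max_right _ _).trans (le_max_left _ _)).trans hM
  refine ⟨M, by exact_mod_cast hM1, fun x hx hxM => ?_⟩
  have hxε : dist x 0 < ε := by
    rw [Real.dist_eq, sub_zero, abs_of_nonneg hx]
    rw [div_le_iff₀ hε] at hMε
    by_contra! hcon
    nlinarith
  have h1 := hball hxε
  simp only [zero_add, FormalMultilinearSeries.partialSum, binomialSeries_apply,
    Real.norm_eq_abs, abs_of_nonneg hx] at h1
  simp only [List.ofFn_const, List.prod_replicate, smul_eq_mul] at h1
  rw [abs_of_nonneg (pow_nonneg hx _)] at h1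
  exact h1.trans (mul_le_mul_of_nonneg_right hMc (by positivity))

lemma exists_binomial_approx (Θ : Finset ℝ) (K : ℕ) :
    ∃ M : ℕ, 1 ≤ M ∧ ∀ θ ∈ Θ, ∀ x : ℝ, 0 ≤ x → x * M ≤ 1 →
      |(1 + x) ^ θ - ∑ i ∈ range (K + 1), Ring.choose θ i * x ^ i| ≤ M * x ^ (K + 1) := by
  choose M hM1 hM using fun θ => exists_binomial_approx_single θ K
  refine ⟨∑ θ ∈ Θ, M θ + 1, by omega, fun θ hθ x hx hxM => ?_⟩
  have hle : (M θ : ℝ) ≤ ((∑ θ ∈ Θ, M θ + 1 : ℕ) : ℝ) := by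
    exact_mod_cast (single_le_sum (f := M) (fun _ _ => Nat.zero_le _) hθ).trans (Nat.le_succ _)
  refine (hM θ x hx (le_trans (by gcongr) hxM)).trans (by gcongr)

lemma succ_mul_choose_succ (θ : ℝ) (i : ℕ) :
    ((i : ℝ) + 1) * Ring.choose θ (i + 1) = (θ - i) * Ring.choose θ i := by
  rw [Ring.choose_eq_smul, Ring.choose_eq_smul, descPochhammer_succ_right, smeval_mul,
    Nat.factorial_succ, smeval_sub, smeval_X, smeval_natCast]
  have : (i.factorial : ℝ) ≠ 0 := by positivity
  simp only [smul_eq_mul, pow_one, pow_zero, nsmul_eq_mul, mul_one]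
  push_cast
  field_simp

lemma choose_ne_zero {θ : ℝ} (hθ : ∀ d : ℕ, θ ≠ d) (i : ℕ) : Ring.choose θ i ≠ 0 := by
  induction i with
  | zero => simp
  | succ i ih =>
    intro h
    have h1 := succ_mul_choose_succ θ i
    rw [h, mul_zero] at h1
    exact mul_ne_zero (sub_ne_zero.mpr (hθ i)) ih h1.symm

lemma exists_elimination (L : ℕ) (Θ : Finset ℝ) (hΘ : ∀ θ ∈ Θ, ∀ d : ℕ, θ ≠ d) :
    ∃ B : ℝ, 0 ≤ B ∧ ∀ (y : ℝ → ℝ) (T : ℝ), 0 ≤ T →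
      (∀ i, L + 1 ≤ i → i ≤ L + #Θ → |∑ θ ∈ Θ, y θ * Ring.choose θ i| ≤ T) →
      ∀ θ ∈ Θ, |y θ| ≤ B * T := by
  induction Θ using Finset.induction_on with
  | empty => exact ⟨0, le_rfl, by simp⟩
  | insert θ₁ Θ hθ₁ ih =>
    obtain ⟨B, hB, ih⟩ := ih fun θ hθ => hΘ θ (mem_insert_of_mem hθ)
    have hnn : ∀ θ ∈ Θ, θ - θ₁ ≠ 0 := fun θ hθ h => hθ₁ (by rwa [← sub_eq_zero.mp h])
    set D := (2 * (L + #Θ + 1 : ℝ) + |θ₁|) with hD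
    have hD0 : 0 ≤ D := by positivity
    set B₁ := ∑ θ ∈ Θ, B * D / |θ - θ₁| with hB₁
    have hB₁0 : 0 ≤ B₁ := sum_nonneg fun θ _ => by positivity
    have hB₁le : ∀ θ ∈ Θ, B * D / |θ - θ₁| ≤ B₁ := fun θ hθ =>
      single_le_sum (f := fun θ => B * D / |θ - θ₁|) (fun θ _ => by positivity) hθ
    set W := ∑ θ ∈ Θ, |Ring.choose θ (L + 1)| with hW
    have hW0 : 0 ≤ W := sum_nonneg fun θ _ => abs_nonneg _
    set a := |Ring.choose θ₁ (L + 1)| with ha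
    have ha0 : 0 < a := abs_pos.mpr (choose_ne_zero (hΘ θ₁ (mem_insert_self _ _)) _)
    refine ⟨B₁ + (1 + B₁ * W) / a, by positivity, fun y T hT h => ?_⟩
    rw [card_insert_of_notMem hθ₁] at h
    have hsmall : ∀ θ ∈ Θ, |y θ| ≤ B₁ * T := by
      intro θ hθ
      have h1 := ih (fun θ => y θ * (θ - θ₁)) (D * T) (by positivity) (fun i hi1 hi2 => by
        have e : ∑ θ ∈ Θ, y θ * (θ - θ₁) * Ring.choose θ i =
            (i + 1) * ∑ θ ∈ insert θ₁ Θ, y θ * Ring.choose θ (i + 1) +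
            (i - θ₁) * ∑ θ ∈ insert θ₁ Θ, y θ * Ring.choose θ i := by
          have : ∑ θ ∈ Θ, y θ * (θ - θ₁) * Ring.choose θ i =
              ∑ θ ∈ insert θ₁ Θ, y θ * (θ - θ₁) * Ring.choose θ i := by
            rw [sum_insert hθ₁]; simp
          rw [this, mul_sum, mul_sum, ← sum_add_distrib]
          refine sum_congr rfl fun θ _ => ?_
          linear_combination (- y θ) * succ_mul_choose_succ θ i
        rw [e]
        have u1 := h (i + 1) (by omega) (by omega)
        have u2 := h i hi1 (by omega)
        have hi : (i : ℝ) ≤ L + #Θ := by exact_mod_cast hi2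
        have hi' : |(i : ℝ) - θ₁| ≤ i + |θ₁| := by
          refine (abs_sub _ _).trans ?_
          rw [abs_of_nonneg (Nat.cast_nonneg i)]
        refine (abs_add_le _ _).trans ?_
        rw [abs_mul, abs_mul, abs_of_nonneg (by positivity : (0 : ℝ) ≤ i + 1)]
        calc _ ≤ ((i : ℝ) + 1) * T + (i + |θ₁|) * T := by gcongr
          _ = (2 * i + 1 + |θ₁|) * T := by ring
          _ ≤ D * T := by gcongr; rw [hD]; linarith) θ hθ
      rw [abs_mul] at h1
      have h2 : 0 < |θ - θ₁| := abs_pos.mpr (hnn θ hθ)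
      calc |y θ| ≤ B * (D * T) / |θ - θ₁| := by rwa [le_div_iff₀ h2]
        _ = B * D / |θ - θ₁| * T := by ring
        _ ≤ _ := by gcongr; exact hB₁le θ hθ
    intro θ hθ
    rw [mem_insert] at hθ
    rcases hθ with rfl | hθ
    · have h1 := h (L + 1) le_rfl (by omega)
      rw [sum_insert hθ₁] at h1
      have h2 : |∑ x ∈ Θ, y x * Ring.choose x (L + 1)| ≤ B₁ * T * W := by
        refine (abs_sum_le_sum_abs _ _).trans ?_
        rw [hW, mul_sum]
        refine sum_le_sum fun x hx => ?_
        rw [abs_mul]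
        gcongr
        exact hsmall x hx
      have h3 : |y θ| * a ≤ T + B₁ * T * W := by
        rw [ha, ← abs_mul]
        calc _ = |(y θ * Ring.choose θ (L + 1) + ∑ x ∈ Θ, y x * Ring.choose x (L + 1)) -
              ∑ x ∈ Θ, y x * Ring.choose x (L + 1)| := by ring_nf
          _ ≤ _ := (abs_sub _ _).trans (add_le_add h1 h2)
      calc |y θ| ≤ (T + B₁ * T * W) / a := by rwa [le_div_iff₀ ha0]
        _ = (1 + B₁ * W) / a * T := by ring
        _ ≤ _ := by gcongr; linarith
    · refine (hsmall θ hθ).trans ?_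
      gcongr
      have : 0 ≤ (1 + B₁ * W) / a := by positivity
      linarith

/-- The Taylor polynomial of degree `K` of `h ↦ ∑ c θ * (m + h) ^ θ`. -/
noncomputable def binomialPoly (Θ : Finset ℝ) (c : ℝ → ℝ) (m : ℝ) (K : ℕ) : ℝ[X] :=
  ∑ i ∈ range (K + 1), C (∑ θ ∈ Θ, c θ * Ring.choose θ i * m ^ (θ - i)) * X ^ i

lemma natDegree_binomialPoly_le (Θ : Finset ℝ) (c : ℝ → ℝ) (m : ℝ) (K : ℕ) :
    (binomialPoly Θ c m K).natDegree ≤ K :=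
  natDegree_sum_le_of_forall_le _ _ fun i hi =>
    (natDegree_C_mul_X_pow_le _ _).trans (by rw [mem_range] at hi; omega)

lemma coeff_binomialPoly (Θ : Finset ℝ) (c : ℝ → ℝ) (m : ℝ) {K i : ℕ} (hi : i ≤ K) :
    (binomialPoly Θ c m K).coeff i = ∑ θ ∈ Θ, c θ * Ring.choose θ i * m ^ (θ - i) := by
  rw [binomialPoly, finsetSum_coeff, sum_eq_single i]
  · rw [coeff_C_mul_X_pow, if_pos rfl]
  · intro j _ hj
    rw [coeff_C_mul_X_pow, if_neg hj.symm]
  · intro h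
    exact absurd (mem_range.mpr (by omega)) h

lemma abs_sub_eval_binomialPoly_le {Θ : Finset ℝ} {K M : ℕ}
    (hM : ∀ θ ∈ Θ, ∀ x : ℝ, 0 ≤ x → x * M ≤ 1 →
      |(1 + x) ^ θ - ∑ i ∈ range (K + 1), Ring.choose θ i * x ^ i| ≤ M * x ^ (K + 1))
    (c : ℝ → ℝ) {m h : ℝ} (hm : 0 < m) (hh : 0 ≤ h) (hhm : h / m * M ≤ 1) :
    |∑ θ ∈ Θ, c θ * (m + h) ^ θ - (binomialPoly Θ c m K).eval h| ≤
      ∑ θ ∈ Θ, |c θ| * m ^ θ * (M * (h / m) ^ (K + 1)) := by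
  have e : ∑ θ ∈ Θ, c θ * (m + h) ^ θ - (binomialPoly Θ c m K).eval h =
      ∑ θ ∈ Θ, c θ * m ^ θ * ((1 + h / m) ^ θ -
        ∑ i ∈ range (K + 1), Ring.choose θ i * (h / m) ^ i) := by
    have : (binomialPoly Θ c m K).eval h =
        ∑ θ ∈ Θ, c θ * m ^ θ * ∑ i ∈ range (K + 1), Ring.choose θ i * (h / m) ^ i := by
      rw [binomialPoly, eval_finsetSum]
      simp only [eval_mul, eval_C, eval_pow, eval_X, sum_mul, mul_sum]
      rw [sum_comm]
      refine sum_congr rfl fun θ _ => sum_congr rfl fun i _ => ?_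
      rw [Real.rpow_sub hm, Real.rpow_natCast, div_pow]
      ring
    rw [this, ← sum_sub_distrib]
    refine sum_congr rfl fun θ _ => ?_
    have : m + h = m * (1 + h / m) := by field_simp
    rw [this, Real.mul_rpow hm.le (by positivity)]
    ring
  rw [e]
  refine (abs_sum_le_sum_abs _ _).trans (sum_le_sum fun θ hθ => ?_)
  rw [abs_mul, abs_mul, abs_of_nonneg (Real.rpow_nonneg hm.le θ)]
  gcongr
  exact hM θ hθ _ (by positivity) hhm

lemma coeff_bounds_of_binomialPoly (L : ℕ) (Θ : Finset ℝ) (hΘ : ∀ θ ∈ Θ, 1 ≤ θ ∧ θ ≤ L)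
    {I : ℕ} (hI : L + #Θ ≤ I) (A : ℕ) :
    ∃ C : ℕ, ∀ R : ℝ, 2 ≤ R → ∀ (T : ℝ) (c : ℝ → ℝ) (m N q : ℕ), R ^ C ≤ T →
      (∀ θ ∈ Θ, |c θ| ≤ R) → 1 ≤ m → m ≤ N → (N : ℝ) = T ^ (I + 1) → (N : ℝ) ≤ 8 * R * m →
      1 ≤ q → (q : ℝ) ≤ R ^ A →
      (∀ i : ℕ, 1 ≤ i → i ≤ I → nearestIntDist
        (q * ∑ θ ∈ Θ, c θ * Ring.choose θ i * (m : ℝ) ^ (θ - i)) * (m : ℝ) ^ i ≤ R ^ A * T ^ I) →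
      (∀ θ ∈ Θ, (∀ d : ℕ, θ ≠ d) → |c θ| * T ≤ R ^ C) ∧
      (∀ d : ℕ, (d : ℝ) ∈ Θ → nearestIntDist (q * c d) * T ≤ R ^ C) := by
  classical
  set Θ' := Θ.filter fun θ : ℝ => ∀ d : ℕ, θ ≠ (d : ℝ) with hΘ'
  have hmem : ∀ {θ : ℝ}, θ ∈ Θ' ↔ θ ∈ Θ ∧ ∀ d : ℕ, θ ≠ (d : ℝ) := by simp [hΘ']
  have hcard : #Θ' ≤ #Θ := card_filter_le _ _
  obtain ⟨B, hB0, hB⟩ := exists_elimination L Θ' fun θ hθ => (hmem.mp hθ).2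
  obtain ⟨W, hW0, hW⟩ : ∃ W : ℝ, 0 ≤ W ∧ ∀ θ ∈ Θ, ∀ i ≤ I, |Ring.choose θ i| ≤ W := by
    refine ⟨∑ θ ∈ Θ, ∑ i ∈ range (I + 1), |Ring.choose θ i|,
      sum_nonneg fun _ _ => sum_nonneg fun _ _ => abs_nonneg _, fun θ hθ i hi => ?_⟩
    exact (single_le_sum (f := fun i => |Ring.choose θ i|) (fun _ _ => abs_nonneg _)
      (mem_range.mpr (by omega))).trans
      (single_le_sum (f := fun θ => ∑ i ∈ range (I + 1), |Ring.choose θ i|)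
        (fun _ _ => sum_nonneg fun _ _ => abs_nonneg _) hθ)
  obtain ⟨κ₁, hκ₁⟩ := exists_le_pow (16 * (#Θ * W))
  obtain ⟨κ₂, hκ₂⟩ := exists_le_pow (8 ^ L * ((L + 1) * 2 ^ L))
  obtain ⟨κ₃, hκ₃⟩ := exists_le_pow (#Θ * W * B + 1)
  obtain ⟨κ₄, hκ₄⟩ := exists_le_pow (8 * B)
  refine ⟨κ₁ + κ₂ + κ₃ + κ₄ + L + 2 * A + 2, fun R hR T c m N q hRT hc hm hmN hNT hNm hq hqR hnd => ?_⟩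
  have hR0 : 0 < R := by linarith
  have hR1 : 1 ≤ R := by linarith
  have hT1 : 1 ≤ T := (one_le_pow₀ hR1).trans hRT
  have hT0 : 0 < T := by linarith
  have hm0 : (1 : ℝ) ≤ m := by exact_mod_cast hm
  have hq0 : (1 : ℝ) ≤ q := by exact_mod_cast hq
  have hTN : T ≤ N := by rw [hNT]; exact le_self_pow₀ hT1 (by omega)
  have hN0 : (0 : ℝ) < N := by linarith
  have hsplit : ∀ i : ℕ, ∑ θ ∈ Θ, c θ * Ring.choose θ i * (m : ℝ) ^ (θ - i) =
      ∑ θ ∈ Θ', c θ * Ring.choose θ i * (m : ℝ) ^ (θ - i) +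
      ∑ θ ∈ Θ.filter (fun θ : ℝ => ¬ ∀ d : ℕ, θ ≠ (d : ℝ)),
        c θ * Ring.choose θ i * (m : ℝ) ^ (θ - i) := fun i =>
    (sum_filter_add_sum_filter_not _ _ _).symm
  have hmpow : ∀ (θ : ℝ) (i : ℕ), (m : ℝ) ^ (θ - i) * (m : ℝ) ^ i = (m : ℝ) ^ θ := fun θ i => by
    rw [← Real.rpow_natCast, ← Real.rpow_add (by linarith), sub_add_cancel]
  have hhigh : ∀ i, L + 1 ≤ i → i ≤ L + #Θ' →
      |∑ θ ∈ Θ', c θ * (m : ℝ) ^ θ * Ring.choose θ i| ≤ R ^ A * T ^ I := by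
    intro i hi1 hi2
    have hiI : i ≤ I := by omega
    have h1 := hnd i (by omega) hiI
    have hzero : ∑ θ ∈ Θ.filter (fun θ : ℝ => ¬ ∀ d : ℕ, θ ≠ (d : ℝ)),
        c θ * Ring.choose θ i * (m : ℝ) ^ (θ - i) = 0 := by
      refine sum_eq_zero fun θ hθ => ?_
      rw [mem_filter] at hθ
      obtain ⟨hθ, h2⟩ := hθ
      push Not at h2
      obtain ⟨d, rfl⟩ := h2
      have : d ≤ L := by exact_mod_cast (hΘ _ hθ).2
      rw [Ring.choose_natCast, Nat.choose_eq_zero_of_lt (by omega)]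
      simp
    rw [hsplit, hzero, add_zero] at h1
    have habs : |∑ θ ∈ Θ', c θ * Ring.choose θ i * (m : ℝ) ^ (θ - i)| ≤
        #Θ * (R * W * (8 * R / T)) := by
      refine (abs_sum_le_sum_abs _ _).trans ?_
      refine (sum_le_card_nsmul Θ' _ (R * W * (8 * R / T)) fun θ hθ => ?_).trans ?_
      · obtain ⟨hθ, -⟩ := hmem.mp hθ
        rw [abs_mul, abs_mul, abs_of_nonneg (Real.rpow_nonneg (by positivity) _)]
        gcongr
        · exact hc θ hθ
        · exact hW θ hθ i hiI
        · calc (m : ℝ) ^ (θ - i) ≤ (m : ℝ) ^ (-1 : ℝ) := by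
                apply Real.rpow_le_rpow_of_exponent_le hm0
                have : (L : ℝ) + 1 ≤ i := by exact_mod_cast hi1
                linarith [(hΘ θ hθ).2]
            _ = 1 / m := by rw [Real.rpow_neg_one, one_div]
            _ ≤ 8 * R / T := by
                rw [div_le_div_iff₀ (by linarith) hT0]
                linarith
      · rw [nsmul_eq_mul]
        have : (#Θ' : ℝ) ≤ #Θ := by exact_mod_cast hcard
        gcongr
    have hhalf : |q * ∑ θ ∈ Θ', c θ * Ring.choose θ i * (m : ℝ) ^ (θ - i)| ≤ 1 / 2 := by
      rw [abs_mul, Nat.abs_cast]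
      calc _ ≤ R ^ A * (#Θ * (R * W * (8 * R / T))) := by gcongr
        _ = (16 * (#Θ * W)) * R ^ (A + 2) / (2 * T) := by field_simp; ring
        _ ≤ R ^ κ₁ * R ^ (A + 2) / (2 * T) := by gcongr; exact hκ₁ R hR
        _ = R ^ (κ₁ + (A + 2)) / (2 * T) := by rw [← pow_add]
        _ ≤ T / (2 * T) := by
            gcongr
            exact (pow_le_pow_right₀ hR1 (by omega)).trans hRT
        _ = 1 / 2 := by field_simp
    rw [nearestIntDist_eq_abs hhalf, abs_mul, Nat.abs_cast] at h1
    have e : ∑ θ ∈ Θ', c θ * (m : ℝ) ^ θ * Ring.choose θ i =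
        (∑ θ ∈ Θ', c θ * Ring.choose θ i * (m : ℝ) ^ (θ - i)) * (m : ℝ) ^ i := by
      rw [sum_mul]
      refine sum_congr rfl fun θ _ => ?_
      rw [← hmpow θ i]; ring
    rw [e, abs_mul, abs_of_nonneg (by positivity : (0 : ℝ) ≤ (m : ℝ) ^ i)]
    refine le_trans ?_ h1
    gcongr
    exact le_mul_of_one_le_left (abs_nonneg _) hq0
  have hsm : ∀ θ ∈ Θ', |c θ| * (m : ℝ) ^ θ ≤ B * (R ^ A * T ^ I) := by
    intro θ hθ
    have := hB (fun θ => c θ * (m : ℝ) ^ θ) _ (by positivity) hhigh θ hθ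
    rwa [abs_mul, abs_of_nonneg (Real.rpow_nonneg (by positivity) _)] at this
  refine ⟨fun θ hθ hθd => ?_, fun d hd => ?_⟩
  · have h1 := hsm θ (hmem.mpr ⟨hθ, hθd⟩)
    have h2 : (m : ℝ) ≤ (m : ℝ) ^ θ := by
      conv_lhs => rw [← Real.rpow_one (m : ℝ)]
      exact Real.rpow_le_rpow_of_exponent_le hm0 (hΘ θ hθ).1
    have h3 : |c θ| * T * T ^ I ≤ R ^ (κ₄ + 1 + A) * T ^ I := by
      calc |c θ| * T * T ^ I = |c θ| * N := by rw [hNT]; ring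
        _ ≤ |c θ| * (8 * R * m) := by gcongr
        _ ≤ |c θ| * (8 * R * (m : ℝ) ^ θ) := by gcongr
        _ = 8 * R * (|c θ| * (m : ℝ) ^ θ) := by ring
        _ ≤ 8 * R * (B * (R ^ A * T ^ I)) := by gcongr
        _ = (8 * B) * R ^ (1 + A) * T ^ I := by ring
        _ ≤ R ^ κ₄ * R ^ (1 + A) * T ^ I := by gcongr; exact hκ₄ R hR
        _ = _ := by rw [← pow_add, add_assoc]
    exact (le_of_mul_le_mul_right h3 (by positivity)).trans (pow_le_pow_right₀ hR1 (by omega))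
  · have hd1 : 1 ≤ d := by exact_mod_cast (hΘ _ hd).1
    have hdL : d ≤ L := by exact_mod_cast (hΘ _ hd).2
    set Pi : ℝ[X] := ∑ d ∈ range (L + 1), C (if (d : ℝ) ∈ Θ then c d else 0) * X ^ d with hPi
    have hdeg : Pi.natDegree ≤ L := natDegree_sum_le_of_forall_le _ _ fun i hi =>
      (natDegree_C_mul_X_pow_le _ _).trans (by rw [mem_range] at hi; omega)
    have hcoeff : ∀ e ≤ L, Pi.coeff e = if (e : ℝ) ∈ Θ then c e else 0 := by
      intro e he
      rw [hPi, finsetSum_coeff, sum_eq_single e]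
      · rw [coeff_C_mul_X_pow, if_pos rfl]
      · intro j _ hj
        rw [coeff_C_mul_X_pow, if_neg hj.symm]
      · intro h
        exact absurd (mem_range.mpr (by omega)) h
    have htaylor : ∀ i, (taylor (m : ℝ) Pi).coeff i =
        ∑ θ ∈ Θ.filter (fun θ : ℝ => ¬ ∀ d : ℕ, θ ≠ (d : ℝ)),
          c θ * Ring.choose θ i * (m : ℝ) ^ (θ - i) := by
      intro i
      rw [coeff_taylor_eq_sum hdeg]
      have e1 : ∑ d ∈ range (L + 1), Pi.coeff d * (d.choose i) * (m : ℝ) ^ (d - i) =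
          ∑ d ∈ (range (L + 1)).filter (fun d : ℕ => (d : ℝ) ∈ Θ),
            c d * (d.choose i) * (m : ℝ) ^ (d - i) := by
        rw [sum_filter]
        refine sum_congr rfl fun d hd => ?_
        rw [mem_range] at hd
        rw [hcoeff d (by omega)]
        split_ifs <;> simp
      rw [e1]
      refine sum_nbij (fun d : ℕ => (d : ℝ)) ?_ ?_ ?_ ?_
      · intro e he
        simp only [mem_filter] at he ⊢
        exact ⟨he.2, fun h => h e rfl⟩
      · intro a _ b _ hab
        exact Nat.cast_injective hab
      · intro θ hθ
        simp only [coe_filter, Set.mem_ofPred_eq] at hθ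
        obtain ⟨hθ, h2⟩ := hθ
        push Not at h2
        obtain ⟨e, rfl⟩ := h2
        have : e ≤ L := by exact_mod_cast (hΘ _ hθ).2
        simp only [coe_filter, Set.mem_image, Set.mem_ofPred_eq]
        exact ⟨e, ⟨mem_range.mpr (by omega), hθ⟩, rfl⟩
      · intro e _
        rw [Ring.choose_natCast]
        rcases le_or_gt i e with h | h
        · rw [← Nat.cast_sub h, Real.rpow_natCast]
        · simp [Nat.choose_eq_zero_of_lt h]
    have hndP : ∀ i, 1 ≤ i → i ≤ L → nearestIntDist (q * (taylor (m : ℝ) Pi).coeff i) *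
        (N : ℝ) ^ i ≤ (8 * R) ^ L * (R ^ (2 * A + κ₃) * T ^ I) := by
      intro i hi1 hi2
      have h1 := hnd i hi1 (by omega)
      rw [hsplit, ← htaylor] at h1
      set S := ∑ θ ∈ Θ', c θ * Ring.choose θ i * (m : ℝ) ^ (θ - i) with hS
      have hSm : |S| * (m : ℝ) ^ i ≤ #Θ * (W * (B * (R ^ A * T ^ I))) := by
        rw [← abs_of_nonneg (by positivity : (0 : ℝ) ≤ (m : ℝ) ^ i), ← abs_mul, hS, sum_mul]
        refine (abs_sum_le_sum_abs _ _).trans ?_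
        refine (sum_le_card_nsmul Θ' _ (W * (B * (R ^ A * T ^ I))) fun θ hθ => ?_).trans ?_
        · rw [mul_assoc, hmpow, mul_right_comm, abs_mul, abs_mul,
            abs_of_nonneg (Real.rpow_nonneg (by positivity : (0 : ℝ) ≤ m) θ), mul_comm]
          exact mul_le_mul (hW θ (hmem.mp hθ).1 i (by omega)) (hsm θ hθ) (by positivity) hW0
        · rw [nsmul_eq_mul]
          have : (#Θ' : ℝ) ≤ #Θ := by exact_mod_cast hcard
          gcongr
      have h2 : nearestIntDist (q * (taylor (m : ℝ) Pi).coeff i) * (m : ℝ) ^ i ≤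
          R ^ (2 * A + κ₃) * T ^ I := by
        have e : (q : ℝ) * (taylor (m : ℝ) Pi).coeff i =
            q * (S + (taylor (m : ℝ) Pi).coeff i) - q * S := by ring
        calc _ ≤ (nearestIntDist (q * (S + (taylor (m : ℝ) Pi).coeff i)) + q * |S|) *
              (m : ℝ) ^ i := by
              gcongr
              rw [e]
              refine (nearestIntDist_sub_le _ _).trans (add_le_add le_rfl ?_)
              refine (nearestIntDist_le_abs _).trans ?_
              rw [abs_mul, Nat.abs_cast]
          _ = nearestIntDist (q * (S + (taylor (m : ℝ) Pi).coeff i)) * (m : ℝ) ^ i +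
              q * (|S| * (m : ℝ) ^ i) := by ring
          _ ≤ R ^ A * T ^ I + R ^ A * (#Θ * (W * (B * (R ^ A * T ^ I)))) := by gcongr
          _ = (#Θ * W * B * R ^ A + 1) * (R ^ A * T ^ I) := by ring
          _ ≤ (#Θ * W * B * R ^ A + R ^ A) * (R ^ A * T ^ I) := by
              gcongr; exact one_le_pow₀ hR1
          _ = (#Θ * W * B + 1) * R ^ (2 * A) * T ^ I := by ring
          _ ≤ R ^ κ₃ * R ^ (2 * A) * T ^ I := by gcongr; exact hκ₃ R hR
          _ = _ := by rw [← pow_add, add_comm κ₃]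
      calc _ ≤ nearestIntDist (q * (taylor (m : ℝ) Pi).coeff i) * (8 * R * m) ^ i := by
            gcongr
            exact nearestIntDist_nonneg _
        _ = (8 * R) ^ i * (nearestIntDist (q * (taylor (m : ℝ) Pi).coeff i) * (m : ℝ) ^ i) := by
            rw [mul_pow (8 * R)]; ring
        _ ≤ _ := by
            gcongr
            · exact mul_nonneg (nearestIntDist_nonneg _) (by positivity)
            · linarith
    have h := nearestIntDist_coeff_le hdeg (Q := 1) (n₀ := m) (N := N) (q := q) le_rfl hmN
      (by positivity : (0 : ℝ) ≤ (8 * R) ^ L * (R ^ (2 * A + κ₃) * T ^ I))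
      (fun i hi1 hi2 => by simpa using hndP i hi1 hi2) hd1
    rw [hcoeff d hdL, if_pos hd] at h
    simp only [one_pow, mul_one, Nat.cast_one] at h
    have hNd : T * T ^ I ≤ (N : ℝ) ^ d := by
      calc T * T ^ I = N := by rw [hNT]; ring
        _ ≤ _ := le_self_pow₀ (by linarith) (by omega)
    have h4 : nearestIntDist (q * c d) * T * T ^ I ≤ R ^ (κ₂ + (L + (2 * A + κ₃))) * T ^ I := by
      calc _ = nearestIntDist (q * c d) * (T * T ^ I) := by ring
        _ ≤ nearestIntDist (q * c d) * (N : ℝ) ^ d := by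
            gcongr; exact nearestIntDist_nonneg _
        _ ≤ _ := h
        _ = (8 ^ L * ((L + 1) * 2 ^ L)) * R ^ (L + (2 * A + κ₃)) * T ^ I := by ring
        _ ≤ R ^ κ₂ * R ^ (L + (2 * A + κ₃)) * T ^ I := by gcongr; exact hκ₂ R hR
        _ = _ := by rw [← pow_add]
    exact (le_of_mul_le_mul_right h4 (by positivity)).trans (pow_le_pow_right₀ hR1 (by omega))

/-- Inverse theorem for exponential sums with real exponents: a large sum forces the
coefficients of the non-integral powers to be small, and those of the integral powers to have
a common small denominator. -/
theorem exists_common_denominator (Θ : Finset ℝ) (hΘ : ∀ θ ∈ Θ, 1 ≤ θ) :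
    ∃ E C : ℕ, 1 ≤ E ∧ ∀ R : ℝ, 2 ≤ R → ∀ T : ℕ, 1 ≤ T → ∀ c : ℝ → ℝ,
      (∀ θ ∈ Θ, |c θ| ≤ R) →
      ((T ^ E : ℕ) : ℝ) / R ≤
        ‖∑ n ∈ range (T ^ E), unitExp (∑ θ ∈ Θ, c θ * ((n : ℝ) + 1) ^ θ)‖ →
      ∃ q : ℕ, 1 ≤ q ∧ (q : ℝ) ≤ R ^ C ∧
        (∀ θ ∈ Θ, (∀ d : ℕ, θ ≠ d) → |c θ| * T ≤ R ^ C) ∧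
        (∀ d : ℕ, (d : ℝ) ∈ Θ → nearestIntDist (q * c d) * T ≤ R ^ C) := by
  obtain ⟨L, hL1, hL⟩ : ∃ L : ℕ, 1 ≤ L ∧ ∀ θ ∈ Θ, 1 ≤ θ ∧ θ ≤ L := by
    refine ⟨∑ θ ∈ Θ, ⌈θ⌉₊ + 1, by omega, fun θ hθ => ⟨hΘ θ hθ, (Nat.le_ceil θ).trans ?_⟩⟩
    exact_mod_cast (single_le_sum (f := fun θ : ℝ => ⌈θ⌉₊) (fun _ _ => Nat.zero_le _) hθ).trans
      (Nat.le_succ _)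
  set I := L + #Θ with hI
  set K := (I + 1) * L with hK
  have hIK : I ≤ K := by rw [hK]; nlinarith
  obtain ⟨Aw, hAw⟩ := weylInverse (K := K) (by omega)
  obtain ⟨C₁, hC₁⟩ := coeff_bounds_of_binomialPoly L Θ hL (I := I) le_rfl (3 * Aw)
  obtain ⟨M, hM1, hM⟩ := exists_binomial_approx Θ K
  obtain ⟨κ₁, hκ₁⟩ := exists_le_pow (8 * M)
  obtain ⟨κ₂, hκ₂⟩ := exists_le_pow (28 * (#Θ * M * 8 ^ (K + 1)))
  set C₀ := C₁ + κ₁ + κ₂ + K + 3 with hC₀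
  refine ⟨I + 1, C₀ + 3 * Aw + 1, by omega, fun R hR T hT c hc hsum => ?_⟩
  have hR0 : 0 < R := by linarith
  have hR1 : 1 ≤ R := by linarith
  have hT0 : (0 : ℝ) < T := by exact_mod_cast hT
  rcases le_or_gt (T : ℝ) (R ^ C₀) with hTR | hTR
  · refine ⟨1, le_rfl, by simpa using one_le_pow₀ hR1, fun θ hθ _ => ?_, fun d hd => ?_⟩
    · calc |c θ| * T ≤ R * R ^ C₀ := by
            gcongr
            exact hc θ hθ
        _ = R ^ (C₀ + 1) := by ring
        _ ≤ _ := pow_le_pow_right₀ hR1 (by omega)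
    · calc _ ≤ 1 * R ^ C₀ := by
            gcongr
            exact (nearestIntDist_le_half _).trans (by norm_num)
        _ ≤ _ := by rw [one_mul]; exact pow_le_pow_right₀ hR1 (by omega)
  have hTC : ∀ {e : ℕ}, e ≤ C₀ → R ^ e ≤ T := fun he =>
    (pow_le_pow_right₀ hR1 he).trans hTR.le
  set N := T ^ (I + 1) with hN
  set H := T ^ I with hH
  have hNH : (N : ℝ) = H * T := by rw [hN, hH]; push_cast; ring
  have hH1 : 1 ≤ H := Nat.one_le_pow _ _ hT
  have hH0 : (0 : ℝ) < H := by exact_mod_cast hH1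
  have hN0 : (0 : ℝ) < N := by rw [hNH]; positivity
  have h8R : 8 * R ≤ T := by
    calc 8 * R ≤ 8 * M * R := by
          have : (1 : ℝ) ≤ M := by exact_mod_cast hM1
          nlinarith
      _ ≤ R ^ κ₁ * R := by gcongr; exact hκ₁ R hR
      _ = R ^ (κ₁ + 1) := by ring
      _ ≤ T := hTC (by omega)
  obtain ⟨n₀, hn₀, hn₀N, hblock⟩ := exists_large_block
    (z := fun n : ℕ => unitExp (∑ θ ∈ Θ, c θ * ((n : ℝ) + 1) ^ θ))
    (N₁ := ⌊N / (8 * R)⌋₊) (fun n => (norm_unitExp _).le) hR hH1 hsum (by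
      have h1 : (⌊(N : ℝ) / (8 * R)⌋₊ : ℝ) ≤ N / (8 * R) := Nat.floor_le (by positivity)
      have h2 : (8 * R) * (N / (8 * R)) = N := by field_simp
      have h3 : 8 * R * H ≤ N := by rw [hNH, mul_comm]; gcongr
      nlinarith)
  set m := n₀ + 1 with hm
  have hmN : m ≤ N := by omega
  have hm1 : (1 : ℝ) ≤ m := by exact_mod_cast Nat.le_add_left 1 n₀
  have hm0 : (0 : ℝ) < m := by linarith
  have hNm : (N : ℝ) ≤ 8 * R * m := by
    have h1 : (N : ℝ) / (8 * R) < m := by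
      refine (Nat.lt_floor_add_one _).trans_le ?_
      exact_mod_cast Nat.succ_le_succ hn₀
    rw [div_lt_iff₀ (by positivity)] at h1
    linarith
  set P := binomialPoly Θ c m K with hP
  have hHm : H / (m : ℝ) ≤ 8 * R / T := by
    rw [div_le_div_iff₀ hm0 hT0]
    linarith
  have happrox : ∀ h ∈ range H, ‖unitExp (∑ θ ∈ Θ, c θ * (((n₀ + h : ℕ) : ℝ) + 1) ^ θ) -
      unitExp (P.eval (h : ℝ))‖ ≤ 1 / (4 * R) := by
    intro h hh
    rw [mem_range] at hh
    have hhm : (h : ℝ) / m ≤ 8 * R / T := by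
      refine le_trans ?_ hHm
      gcongr
    have hhM : (h : ℝ) / m * M ≤ 1 := by
      calc _ ≤ 8 * R / T * M := by gcongr
        _ = 8 * M * R / T := by ring
        _ ≤ R ^ κ₁ * R / T := by gcongr; exact hκ₁ R hR
        _ = R ^ (κ₁ + 1) / T := by rw [pow_succ]
        _ ≤ 1 := by
            rw [div_le_one hT0]
            exact hTC (by omega)
    have h1 := abs_sub_eval_binomialPoly_le hM c hm0 (Nat.cast_nonneg h) hhM
    have e : ((n₀ + h : ℕ) : ℝ) + 1 = m + h := by rw [hm]; push_cast; ring
    rw [e]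
    refine (norm_unitExp_sub_le _ _).trans ?_
    have h2 : ∑ θ ∈ Θ, |c θ| * (m : ℝ) ^ θ * (M * (h / m : ℝ) ^ (K + 1)) ≤
        #Θ * (R * (T : ℝ) ^ K * (M * (8 * R / T) ^ (K + 1))) := by
      refine (sum_le_card_nsmul Θ _ (R * (T : ℝ) ^ K * (M * (8 * R / T) ^ (K + 1)))
        fun θ hθ => ?_).trans (by rw [nsmul_eq_mul])
      gcongr
      · exact hc θ hθ
      · calc (m : ℝ) ^ θ ≤ (m : ℝ) ^ (L : ℝ) :=
              Real.rpow_le_rpow_of_exponent_le hm1 (hL θ hθ).2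
          _ = (m : ℝ) ^ L := Real.rpow_natCast _ _
          _ ≤ (N : ℝ) ^ L := by gcongr
          _ = (T : ℝ) ^ K := by rw [hN]; push_cast; rw [← pow_mul]
    calc 7 * nearestIntDist _ ≤ 7 * (#Θ * (R * (T : ℝ) ^ K * (M * (8 * R / T) ^ (K + 1)))) := by
          gcongr
          exact (nearestIntDist_le_abs _).trans (h1.trans h2)
      _ = (28 * (#Θ * M * 8 ^ (K + 1))) * R ^ (K + 3) / T / (4 * R) := by
          rw [div_pow, mul_pow, pow_succ (T : ℝ)]
          field_simp
          ring
      _ ≤ R ^ κ₂ * R ^ (K + 3) / T / (4 * R) := by gcongr; exact hκ₂ R hR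
      _ = R ^ (κ₂ + (K + 3)) / T / (4 * R) := by rw [← pow_add]
      _ ≤ 1 / (4 * R) := by
          gcongr
          rw [div_le_one hT0]
          exact hTC (by omega)
  have hPsum : (H : ℝ) / R ^ 3 ≤ ‖∑ h ∈ range H, unitExp (P.eval (h : ℝ))‖ := by
    have h1 : ‖∑ h ∈ range H, unitExp (∑ θ ∈ Θ, c θ * (((n₀ + h : ℕ) : ℝ) + 1) ^ θ) -
        ∑ h ∈ range H, unitExp (P.eval (h : ℝ))‖ ≤ H * (1 / (4 * R)) := by
      rw [← sum_sub_distrib]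
      refine (norm_sum_le_of_le _ happrox).trans ?_
      simp
    have h2 := norm_sub_norm_le (∑ h ∈ range H, unitExp (∑ θ ∈ Θ, c θ *
      (((n₀ + h : ℕ) : ℝ) + 1) ^ θ)) (∑ h ∈ range H, unitExp (P.eval (h : ℝ)))
    have h3 : (H : ℝ) / R ^ 3 ≤ H / (4 * R) := by
      gcongr
      nlinarith [mul_le_mul hR hR (by norm_num) hR0.le]
    have h4 : (H : ℝ) / (2 * R) - H * (1 / (4 * R)) = H / (4 * R) := by field_simp; ring
    linarith
  obtain ⟨q, hq1, hqR, hq⟩ := hAw (R ^ 3) (by nlinarith [pow_le_pow_left₀ (by norm_num) hR 3]) H hH1 P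
    (natDegree_binomialPoly_le _ _ _ _) hPsum
  rw [← pow_mul] at hqR hq
  obtain ⟨h1, h2⟩ := hC₁ R hR T c m N q (hTC (by omega)) hc (by omega) hmN
    (by rw [hN]; push_cast; ring) hNm hq1 hqR (fun i hi1 hi2 => by
      have h := hq i hi1 (by omega)
      rw [hP, coeff_binomialPoly _ _ _ (by omega)] at h
      calc _ ≤ nearestIntDist _ * (N : ℝ) ^ i := by
            gcongr
            exact nearestIntDist_nonneg _
        _ = nearestIntDist _ * (H : ℝ) ^ i * (T : ℝ) ^ i := by rw [hNH, mul_pow]; ring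
        _ ≤ _ := by
            gcongr
            exact_mod_cast hT)
  refine ⟨q, hq1, hqR.trans (pow_le_pow_right₀ hR1 (by omega)), fun θ hθ hd => ?_, fun d hd => ?_⟩
  · exact (h1 θ hθ hd).trans (pow_le_pow_right₀ hR1 (by omega))
  · exact (h2 d hd).trans (pow_le_pow_right₀ hR1 (by omega))

/-- The trigonometric polynomial `cos (π x) ^ (2 * M)`. -/
noncomputable def cosKernel (M : ℕ) (x : ℝ) : ℂ :=
  ∑ j ∈ range (2 * M + 1), (((2 * M).choose j : ℝ) / 4 ^ M : ℝ) * unitExp (((j : ℝ) - M) * x)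

lemma cosKernel_eq (M : ℕ) (x : ℝ) :
    cosKernel M x = unitExp (-(M * x)) * ((1 + unitExp x) / 2) ^ (2 * M) := by
  rw [div_pow, add_comm, add_pow, cosKernel, sum_div, mul_sum]
  refine sum_congr rfl fun j _ => ?_
  have e : ((j : ℝ) - M) * x = -(M * x) + j * x := by ring
  rw [e, unitExp_add, unitExp_nat_mul, pow_mul 2 2 M]
  push_cast
  norm_num
  ring

lemma norm_one_add_unitExp_sq (x : ℝ) :
    ‖1 + unitExp x‖ ^ 2 ≤ 4 * (1 - 4 * nearestIntDist x ^ 2) := by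
  have h1 := parallelogram_law_with_norm ℝ (1 : ℂ) (unitExp x)
  have h2 := four_mul_nearestIntDist_le x
  rw [norm_sub_rev] at h2
  have h3 : (4 * nearestIntDist x) ^ 2 ≤ ‖1 - unitExp x‖ ^ 2 :=
    pow_le_pow_left₀ (by linarith [nearestIntDist_nonneg x]) h2 2
  rw [norm_unitExp, norm_one] at h1
  nlinarith

lemma norm_cosKernel_le (M : ℕ) (x : ℝ) :
    ‖cosKernel M x‖ ≤ (1 - 4 * nearestIntDist x ^ 2) ^ M := by
  rw [cosKernel_eq, norm_mul, norm_unitExp, one_mul, pow_mul, norm_pow]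
  gcongr
  rw [norm_pow, norm_div, div_pow]
  have := norm_one_add_unitExp_sq x
  norm_num
  linarith

lemma norm_cosKernel_le_one (M : ℕ) (x : ℝ) : ‖cosKernel M x‖ ≤ 1 := by
  refine (norm_cosKernel_le M x).trans (pow_le_one₀ ?_ ?_)
  · have h1 := nearestIntDist_le_half x
    have h2 := nearestIntDist_nonneg x
    nlinarith
  · nlinarith [nearestIntDist_nonneg x]

/-- If the points `x n` all avoid the box of side `1 / R` around the integer lattice, then some
exponential sum of low frequency is large. -/
theorem exists_large_exponential_sum (D : ℕ) :
    ∃ C : ℕ, ∀ R : ℝ, 2 ≤ R → ∀ N : ℕ, 1 ≤ N → ∀ x : ℕ → Fin D → ℝ,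
      (∀ n < N, ∃ j, 1 / R < nearestIntDist (x n j)) →
      ∃ h : Fin D → ℤ, h ≠ 0 ∧ (∀ j, |(h j : ℝ)| ≤ R ^ C) ∧
        (N : ℝ) / R ^ C ≤ ‖∑ n ∈ range N, unitExp (∑ j, h j * x n j)‖ := by
  set k := 2 * D + 2 with hk
  obtain ⟨κ, hκ⟩ := exists_le_pow (4 * (3 * k : ℝ) ^ D)
  refine ⟨(k + 2 * (κ + 3)) + 2 + (k + 2 * (κ + 3) + 2) * D, fun R hR N hN x hx => ?_⟩
  have hR0 : 0 < R := by linarith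
  have hR1 : 1 ≤ R := by linarith
  have hN0 : (0 : ℝ) < N := by exact_mod_cast hN
  obtain ⟨Q, hQ1, hQ2⟩ : ∃ Q : ℕ, R ^ (κ + 2) ≤ Q ∧ (Q : ℝ) ≤ R ^ (κ + 3) := by
    refine ⟨⌈R ^ (κ + 2)⌉₊, Nat.le_ceil _, (Nat.ceil_lt_add_one (by positivity)).le.trans ?_⟩
    have : 1 ≤ R ^ (κ + 2) := one_le_pow₀ hR1
    rw [pow_succ R (κ + 2)]
    nlinarith
  have hQR2 : R ^ 2 ≤ Q := (pow_le_pow_right₀ hR1 (by omega)).trans hQ1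
  have hQκ : R ^ κ ≤ Q := (pow_le_pow_right₀ hR1 (by omega)).trans hQ1
  have hQ0 : (1 : ℝ) ≤ Q := (one_le_pow₀ hR1).trans hQR2
  set M := k * Q ^ 2 with hM
  have hM1 : (1 : ℝ) ≤ M := by
    rw [hM]; push_cast
    have : (1 : ℝ) ≤ k := by rw [hk]; exact_mod_cast (by omega : 1 ≤ 2 * D + 2)
    nlinarith [one_le_pow₀ hQ0 (n := 2)]
  have hMR : (M : ℝ) ≤ R ^ (k + 2 * (κ + 3)) := by
    rw [hM, pow_add, pow_mul' R 2]
    push_cast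
    gcongr
    exact natCast_le_pow hR k
  have hMR' : (2 * M + 1 : ℝ) ≤ R ^ (k + 2 * (κ + 3) + 2) := by
    rw [pow_add]
    nlinarith [mul_le_mul hR hR (by norm_num) hR0.le]
  set u := 4 / R ^ 2 with hu
  have hu0 : 0 < u := by positivity
  have hu1 : u ≤ 1 := by
    rw [hu, div_le_one (by positivity)]; nlinarith
  have hsmall : (1 - u) ^ M ≤ 1 / (4 * (2 * M + 1 : ℝ) ^ D) := by
    have h1 : (1 - u) ^ Q ^ 2 ≤ 1 / Q := by
      have h2 : (1 - u) ^ Q ^ 2 * (1 + u) ^ Q ^ 2 ≤ 1 := by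
        rw [← mul_pow]
        exact pow_le_one₀ (by nlinarith) (by nlinarith)
      have h3 : (Q : ℝ) ≤ (1 + u) ^ Q ^ 2 := by
        refine le_trans ?_ (one_add_mul_le_pow (by linarith) _)
        push_cast
        have : (Q : ℝ) ^ 2 * u = Q * (4 * (Q / R ^ 2)) := by rw [hu]; ring
        rw [this]
        have : 1 ≤ (Q : ℝ) / R ^ 2 := by rwa [one_le_div (by positivity)]
        nlinarith
      rw [le_div_iff₀ (by linarith)]
      refine le_trans ?_ h2
      gcongr
    have h2 : 4 * (2 * M + 1 : ℝ) ^ D ≤ (Q : ℝ) ^ k := by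
      calc 4 * (2 * M + 1 : ℝ) ^ D ≤ 4 * (3 * M : ℝ) ^ D := by gcongr; linarith
        _ = (4 * (3 * k : ℝ) ^ D) * ((Q : ℝ) ^ 2) ^ D := by
            rw [hM]; push_cast; rw [← mul_assoc, mul_pow]; ring
        _ ≤ Q ^ 2 * ((Q : ℝ) ^ 2) ^ D := by
            gcongr
            exact (hκ R hR).trans (hQκ.trans (le_self_pow₀ hQ0 (by norm_num)))
        _ = (Q : ℝ) ^ k := by rw [hk, ← pow_mul, ← pow_add, add_comm]
    calc (1 - u) ^ M = ((1 - u) ^ Q ^ 2) ^ k := by rw [hM, mul_comm, pow_mul]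
      _ ≤ (1 / Q) ^ k := by
          gcongr
      _ = 1 / (Q : ℝ) ^ k := by rw [div_pow, one_pow]
      _ ≤ _ := by gcongr
  set a : ℕ → ℝ := fun j => ((2 * M).choose j : ℝ) / 4 ^ M with ha
  have ha0 : ∀ j, 0 ≤ a j := fun j => by positivity
  have hasum : ∑ j ∈ range (2 * M + 1), a j = 1 := by
    rw [ha, ← sum_div]
    have := Nat.sum_range_choose (2 * M)
    have h2 : (∑ j ∈ range (2 * M + 1), ((2 * M).choose j : ℝ)) = 4 ^ M := by
      rw [← Nat.cast_sum, this, pow_mul]; norm_num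
    rw [h2, div_self (by positivity)]
  have haM : 1 / (2 * M + 1 : ℝ) ≤ a M := by
    have h := Nat.four_pow_le_two_mul_add_one_mul_central_binom M
    have h' : (4 : ℝ) ^ M ≤ (2 * M + 1) * (2 * M).choose M := by exact_mod_cast h
    rw [ha, div_le_div_iff₀ (by positivity) (by positivity)]
    linarith
  set C := (k + 2 * (κ + 3)) + 2 + (k + 2 * (κ + 3) + 2) * D with hC
  have hRC : 4 * (2 * M + 1 : ℝ) ^ D ≤ R ^ C := by
    calc 4 * (2 * M + 1 : ℝ) ^ D ≤ R ^ 2 * (R ^ (k + 2 * (κ + 3) + 2)) ^ D := by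
          gcongr
          nlinarith
      _ = R ^ (2 + (k + 2 * (κ + 3) + 2) * D) := by rw [← pow_mul, ← pow_add]
      _ ≤ _ := pow_le_pow_right₀ hR1 (by omega)
  by_contra! hcon
  set S := Fintype.piFinset fun _ : Fin D => range (2 * M + 1) with hS
  have hexpand : ∑ n ∈ range N, ∏ j, cosKernel M (x n j) =
      ∑ J ∈ S, ((∏ j, a (J j) : ℝ) : ℂ) *
        ∑ n ∈ range N, unitExp (∑ j, (((J j : ℤ) - M : ℤ) : ℝ) * x n j) := by
    simp only [mul_sum]
    rw [sum_comm]
    refine sum_congr rfl fun n _ => ?_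
    simp only [cosKernel]
    rw [prod_univ_sum]
    refine sum_congr rfl fun J _ => ?_
    rw [prod_mul_distrib]
    congr 1
    · rw [Complex.ofReal_prod]
    · have hprod : ∀ (s : Finset (Fin D)) (y : Fin D → ℝ),
          ∏ j ∈ s, unitExp (y j) = unitExp (∑ j ∈ s, y j) := by
        intro s y
        induction s using Finset.induction_on with
        | empty => simp [unitExp_zero]
        | insert i s hi ih => rw [prod_insert hi, sum_insert hi, unitExp_add, ih]
      rw [hprod]
      push_cast
      rfl
  have hMS : (fun _ => M) ∈ S := by
    rw [hS, Fintype.mem_piFinset]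
    intro j
    rw [mem_range]; omega
  have hLHS : ‖∑ n ∈ range N, ∏ j, cosKernel M (x n j)‖ ≤ N * (1 / (4 * (2 * M + 1 : ℝ) ^ D)) := by
    refine (norm_sum_le_of_le (f := fun n => ∏ j, cosKernel M (x n j)) (range N)
      (n := fun _ => 1 / (4 * (2 * M + 1 : ℝ) ^ D)) fun n hn => ?_).trans (by simp)
    obtain ⟨j, hj⟩ := hx n (mem_range.mp hn)
    rw [norm_prod, ← mul_prod_erase univ _ (mem_univ j)]
    calc _ ≤ ‖cosKernel M (x n j)‖ * 1 := by
          gcongr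
          exact prod_le_one (fun _ _ => norm_nonneg _) fun i _ => norm_cosKernel_le_one _ _
      _ ≤ (1 - u) ^ M := by
          rw [mul_one]
          refine (norm_cosKernel_le _ _).trans ?_
          gcongr
          · have h1 := nearestIntDist_le_half (x n j)
            have h2 := nearestIntDist_nonneg (x n j)
            nlinarith
          · have h1 : (1 / R) ^ 2 ≤ nearestIntDist (x n j) ^ 2 :=
              pow_le_pow_left₀ (by positivity) hj.le 2
            have h2 : u = 4 * (1 / R) ^ 2 := by rw [hu]; ring
            linarith
      _ ≤ _ := hsmall
  rw [hexpand, ← add_sum_erase _ _ hMS] at hLHS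
  have hmain : (N : ℝ) * (1 / (2 * M + 1 : ℝ) ^ D) ≤ ‖((∏ _j : Fin D, a M : ℝ) : ℂ) *
        ∑ n ∈ range N, unitExp (∑ j, (((M : ℤ) - M : ℤ) : ℝ) * x n j)‖ := by
    simp only [sub_self, Int.cast_zero, zero_mul, sum_const_zero, unitExp_zero, sum_const,
      card_range, nsmul_eq_mul, mul_one, norm_mul, prod_const, card_univ, Fintype.card_fin,
      Complex.norm_real, Complex.norm_natCast, Real.norm_eq_abs]
    rw [abs_of_nonneg (pow_nonneg (ha0 M) D), mul_comm, ← one_div_pow]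
    gcongr
  have hrest : ‖∑ J ∈ S.erase (fun _ => M), ((∏ j, a (J j) : ℝ) : ℂ) *
        ∑ n ∈ range N, unitExp (∑ j, (((J j : ℤ) - M : ℤ) : ℝ) * x n j)‖ ≤
      N * (1 / (4 * (2 * M + 1 : ℝ) ^ D)) := by
    calc _ ≤ ∑ J ∈ S.erase (fun _ => M), (∏ j, a (J j)) * (N * (1 / (4 * (2 * M + 1 : ℝ) ^ D))) := by
          refine norm_sum_le_of_le _ fun J hJ => ?_
          rw [mem_erase, hS, Fintype.mem_piFinset] at hJ
          rw [norm_mul, Complex.norm_real, Real.norm_eq_abs,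
            abs_of_nonneg (prod_nonneg fun j _ => ha0 _)]
          refine mul_le_mul_of_nonneg_left ?_ (prod_nonneg fun j _ => ha0 _)
          refine ((hcon (fun j => (J j : ℤ) - M) ?_ fun j => ?_).le).trans ?_
          · intro h
            apply hJ.1
            funext j
            have := congrFun h j
            simp only [Pi.zero_apply] at this
            omega
          · have h1 : |(J j : ℤ) - M| ≤ M := by
              have := hJ.2 j
              rw [mem_range] at this
              rw [abs_le]; omega
            calc _ ≤ (M : ℝ) := by exact_mod_cast h1
              _ ≤ _ := hMR.trans (pow_le_pow_right₀ hR1 (by omega))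
          · rw [mul_one_div]
            gcongr
      _ ≤ ∑ J ∈ S, (∏ j, a (J j)) * (N * (1 / (4 * (2 * M + 1 : ℝ) ^ D))) :=
          sum_le_sum_of_subset_of_nonneg (erase_subset _ _) fun J _ _ =>
            mul_nonneg (prod_nonneg fun j _ => ha0 _) (by positivity)
      _ = _ := by
          rw [← sum_mul, hS, ← prod_univ_sum (fun _ : Fin D => range (2 * M + 1)) fun _ j => a j,
            hasum]
          simp
  have htri := norm_le_norm_add_norm_sub' (((∏ _j : Fin D, a M : ℝ) : ℂ) *
        ∑ n ∈ range N, unitExp (∑ j, (((M : ℤ) - M : ℤ) : ℝ) * x n j))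
    (-∑ J ∈ S.erase (fun _ => M), ((∏ j, a (J j) : ℝ) : ℂ) *
        ∑ n ∈ range N, unitExp (∑ j, (((J j : ℤ) - M : ℤ) : ℝ) * x n j))
  rw [norm_neg, sub_neg_eq_add] at htri
  have hpos : 0 < (N : ℝ) * (1 / (2 * M + 1 : ℝ) ^ D) := by positivity
  have hquarter : (N : ℝ) * (1 / (4 * (2 * M + 1 : ℝ) ^ D)) =
      (N * (1 / (2 * M + 1 : ℝ) ^ D)) / 4 := by field_simp
  rw [hquarter] at hLHS hrest
  linarith

lemma nearestIntDist_mul_rpow_div_le {q m : ℕ} {H : ℤ} (hH : H ≠ 0) {d L : ℕ} (hd : 1 ≤ d)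
    (hdL : d ≤ L) (hn : 1 ≤ H.natAbs * q * m) (c : ℝ) :
    nearestIntDist (c * ((H.natAbs * q * m : ℕ) : ℝ) ^ d / H) ≤
      nearestIntDist (q * c) * ((H.natAbs * q * m : ℕ) : ℝ) ^ L := by
  obtain ⟨e, rfl⟩ : ∃ e, d = e + 1 := ⟨d - 1, by omega⟩
  have hH0 : (H : ℝ) ≠ 0 := by exact_mod_cast hH
  set u := H.natAbs * q with hu
  have hm : 1 ≤ m := Nat.pos_of_ne_zero fun h => by simp [h] at hn
  have hu1 : 1 ≤ u := Nat.pos_of_ne_zero fun h => by simp [h] at hn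
  have habs : ((H.natAbs : ℕ) : ℝ) = H.sign * H := by
    have h1 : H.sign * H = |H| := Int.sign_mul_self_eq_abs H
    rw [Nat.cast_natAbs, ← h1]; push_cast; rfl
  have e1 : c * ((u * m : ℕ) : ℝ) ^ (e + 1) / H =
      ((H.sign * (u ^ e * m ^ (e + 1) : ℕ) : ℤ) : ℝ) * (q * c) := by
    push_cast
    rw [mul_pow, pow_succ (u : ℝ) e]
    nth_rewrite 2 [hu]
    rw [Nat.cast_mul, habs]
    field_simp
  rw [e1]
  refine (nearestIntDist_int_mul_le _ _).trans ?_
  rw [mul_comm]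
  refine mul_le_mul_of_nonneg_left ?_ (nearestIntDist_nonneg _)
  have h2 : |H.sign| = 1 := by
    rw [Int.abs_sign_of_ne_zero hH]
  rw [← Int.cast_abs, abs_mul, h2, one_mul, Nat.abs_cast, Int.cast_natCast]
  rw [← Nat.cast_pow, Nat.cast_le]
  calc u ^ e * m ^ (e + 1) ≤ u ^ (e + 1) * m ^ (e + 1) := by gcongr; omega
    _ = (u * m) ^ (e + 1) := (mul_pow _ _ _).symm
    _ ≤ (u * m) ^ L := Nat.pow_le_pow_right hn hdL

/-- Simultaneous inhomogeneous approximation for `D` generalised polynomials with exponents in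
`Θ`, where the shifts may only occur at non-integral exponents. -/
def SmallValues (Θ : Finset ℝ) (D : ℕ) : Prop :=
  ∃ C : ℕ, ∀ R : ℝ, 2 ≤ R → ∀ b : Fin D → ℝ → ℝ, (∀ j, ∀ θ ∈ Θ, |b j θ| ≤ R) →
    ∀ s : ℝ → ℝ, (∀ θ ∈ Θ, |s θ| ≤ 1) → (∀ d : ℕ, s d = 0) →
    ∃ n : ℕ, 1 ≤ n ∧ (n : ℝ) ≤ R ^ C ∧
      ∀ j, nearestIntDist (∑ θ ∈ Θ, b j θ * ((n : ℝ) ^ θ - s θ)) ≤ 1 / R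

lemma SmallValues.succ {Θ : Finset ℝ} (hΘ : ∀ θ ∈ Θ, 1 ≤ θ) {D : ℕ} (hD : SmallValues Θ D) :
    SmallValues Θ (D + 1) := by
  obtain ⟨CD, hCD⟩ := hD
  obtain ⟨CF, hCF⟩ := exists_large_exponential_sum (D + 1)
  obtain ⟨E, CW, hE, hCW⟩ := exists_common_denominator Θ hΘ
  obtain ⟨L, hL⟩ : ∃ L : ℕ, ∀ θ ∈ Θ, 1 ≤ θ ∧ θ ≤ L := by
    refine ⟨∑ θ ∈ Θ, ⌈θ⌉₊, fun θ hθ => ⟨hΘ θ hθ, (Nat.le_ceil θ).trans ?_⟩⟩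
    exact_mod_cast single_le_sum (f := fun θ : ℝ => ⌈θ⌉₊) (fun _ _ => Nat.zero_le _) hθ
  obtain ⟨κ, hκ⟩ := exists_le_pow (2 * #Θ)
  set a := CF + 1 + (D + 1) with ha
  set w := CF + a * CW with hw
  set A := w * L + CF + D + 2 with hA
  set v := w + A * CD with hv
  set B := a * CW + v * L + κ + 2 with hB
  refine ⟨v + 2 * (B * E), fun R hR b hb s hs hs0 => ?_⟩
  have hR0 : 0 < R := by linarith
  have hR1 : 1 ≤ R := by linarith
  set T := ⌈R⌉₊ ^ B with hT
  have hceil : (⌈R⌉₊ : ℝ) ≤ R ^ 2 := (Nat.ceil_lt_add_one hR0.le).le.trans (by nlinarith)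
  have hTB : R ^ B ≤ T := by
    rw [hT]; push_cast
    gcongr
    exact Nat.le_ceil R
  have hT1 : 1 ≤ T := by
    have : (1 : ℝ) ≤ T := (one_le_pow₀ hR1).trans hTB
    exact_mod_cast this
  have hT0 : (0 : ℝ) < T := by exact_mod_cast hT1
  have hN1 : 1 ≤ T ^ E := Nat.one_le_pow _ _ hT1
  by_cases hgood : ∃ n < T ^ E, ∀ j,
      nearestIntDist (∑ θ ∈ Θ, b j θ * (((n + 1 : ℕ) : ℝ) ^ θ - s θ)) ≤ 1 / R
  · obtain ⟨n, hn, h⟩ := hgood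
    refine ⟨n + 1, by omega, ?_, h⟩
    calc ((n + 1 : ℕ) : ℝ) ≤ ((T ^ E : ℕ) : ℝ) := by exact_mod_cast hn
      _ = (⌈R⌉₊ : ℝ) ^ (B * E) := by rw [hT]; push_cast; rw [← pow_mul]
      _ ≤ (R ^ 2) ^ (B * E) := by gcongr
      _ = R ^ (2 * (B * E)) := (pow_mul _ _ _).symm
      _ ≤ _ := pow_le_pow_right₀ hR1 (by omega)
  push Not at hgood
  obtain ⟨h, hne, hh, hlarge⟩ := hCF R hR (T ^ E) hN1
    (fun n j => ∑ θ ∈ Θ, b j θ * (((n + 1 : ℕ) : ℝ) ^ θ - s θ)) hgood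
  set c : ℝ → ℝ := fun θ => ∑ j, h j * b j θ with hc
  have hcomb : ∀ y : ℝ → ℝ, ∑ j, (h j : ℝ) * ∑ θ ∈ Θ, b j θ * y θ = ∑ θ ∈ Θ, c θ * y θ := by
    intro y
    simp only [hc, mul_sum, sum_mul]
    rw [sum_comm]
    exact sum_congr rfl fun _ _ => sum_congr rfl fun _ _ => by ring
  have hcR : ∀ θ ∈ Θ, |c θ| ≤ R ^ a := by
    intro θ hθ
    refine (abs_sum_le_sum_abs _ _).trans ?_
    refine (sum_le_card_nsmul univ _ (R ^ CF * R) fun j _ => ?_).trans ?_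
    · rw [abs_mul]
      gcongr
      · exact hh j
      · exact hb j θ hθ
    · rw [card_univ, Fintype.card_fin, nsmul_eq_mul, ha, pow_add, pow_succ R CF, mul_comm]
      gcongr
      exact natCast_le_pow hR _
  obtain ⟨q, hq1, hqR, hqn, hqd⟩ := hCW (R ^ a) (hR.trans (le_self_pow₀ hR1 (by omega))) T hT1 c hcR
    (by
      have e : ∀ n : ℕ, unitExp (∑ j, (h j : ℝ) * ∑ θ ∈ Θ, b j θ * (((n + 1 : ℕ) : ℝ) ^ θ - s θ)) =
          unitExp (∑ θ ∈ Θ, c θ * ((n : ℝ) + 1) ^ θ) * unitExp (-∑ θ ∈ Θ, c θ * s θ) := by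
        intro n
        rw [hcomb fun θ => ((n + 1 : ℕ) : ℝ) ^ θ - s θ, ← unitExp_add, ← sub_eq_add_neg,
          ← sum_sub_distrib]
        push_cast
        congr 1
        exact sum_congr rfl fun _ _ => by ring
      rw [sum_congr rfl fun n _ => e n, ← sum_mul, norm_mul, norm_unitExp, mul_one] at hlarge
      refine le_trans ?_ hlarge
      gcongr
      · omega)
  rw [← pow_mul] at hqR hqn hqd
  obtain ⟨j₀, hj₀⟩ := Function.ne_iff.mp hne
  set H := h j₀ with hH
  have hHne : H ≠ 0 := hj₀
  have hH0 : (H : ℝ) ≠ 0 := by exact_mod_cast hHne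
  have hH1 : (1 : ℝ) ≤ |(H : ℝ)| := by exact_mod_cast Int.one_le_abs hHne
  set u := H.natAbs * q with hu
  have hu1 : 1 ≤ u := Nat.mul_pos (Int.natAbs_pos.mpr hHne) hq1
  have hu1' : (1 : ℝ) ≤ u := by exact_mod_cast hu1
  have huw : (u : ℝ) ≤ R ^ w := by
    rw [hu, hw, pow_add]
    push_cast
    rw [Nat.cast_natAbs, Int.cast_abs]
    exact mul_le_mul (hh j₀) hqR (by positivity) (by positivity)
  have hpow : ∀ {x : ℝ}, 1 ≤ x → ∀ θ ∈ Θ, x ^ θ ≤ x ^ L := fun hx θ hθ => by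
    rw [← Real.rpow_natCast]
    exact Real.rpow_le_rpow_of_exponent_le hx (hL θ hθ).2
  have hupos : ∀ θ : ℝ, 0 < (u : ℝ) ^ θ := fun θ => Real.rpow_pos_of_pos (by linarith) θ
  obtain ⟨m, hm1, hmR, hm⟩ := hCD (R ^ A) (hR.trans (le_self_pow₀ hR1 (by omega)))
    (fun i θ => b (j₀.succAbove i) θ * (u : ℝ) ^ θ / H) (fun i θ hθ => by
      rw [abs_div, abs_mul, abs_of_pos (hupos θ)]
      calc _ ≤ R * (R ^ w) ^ L / 1 := by
            gcongr
            · exact hb _ θ hθ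
            · exact (hpow hu1' θ hθ).trans (by gcongr)
        _ = R ^ (1 + w * L) := by rw [div_one, ← pow_mul, pow_add, pow_one]
        _ ≤ R ^ A := pow_le_pow_right₀ hR1 (by omega))
    (fun θ => s θ / (u : ℝ) ^ θ) (fun θ hθ => by
      rw [abs_div, abs_of_pos (hupos θ), div_le_one (hupos θ)]
      exact (hs θ hθ).trans (Real.one_le_rpow hu1' (by linarith [hΘ θ hθ])))
    (fun d => by rw [hs0, zero_div])
  rw [← pow_mul] at hmR
  set n := u * m with hn
  have hn1 : 1 ≤ n := Nat.mul_pos hu1 hm1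
  have hn1' : (1 : ℝ) ≤ n := by exact_mod_cast hn1
  have hnv : (n : ℝ) ≤ R ^ v := by
    rw [hn, hv, pow_add]
    push_cast
    exact mul_le_mul huw hmR (by positivity) (by positivity)
  set Y : Fin (D + 1) → ℝ := fun j => ∑ θ ∈ Θ, b j θ * ((n : ℝ) ^ θ - s θ) with hY
  have hYm : ∀ i, nearestIntDist (Y (j₀.succAbove i) / H) ≤ 1 / R ^ A := by
    intro i
    convert hm i using 2
    rw [hY, sum_div]
    refine sum_congr rfl fun θ _ => ?_
    have := (hupos θ).ne'
    rw [hn, Nat.cast_mul, Real.mul_rpow (by positivity) (by positivity)]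
    field_simp
  refine ⟨n, hn1, hnv.trans (pow_le_pow_right₀ hR1 (by omega)), fun j => ?_⟩
  change nearestIntDist (Y j) ≤ 1 / R
  rcases Fin.eq_self_or_eq_succAbove j₀ j with rfl | ⟨i, rfl⟩
  swap
  · have e : Y (j₀.succAbove i) = H * (Y (j₀.succAbove i) / H) := by field_simp
    rw [e]
    calc _ ≤ |(H : ℝ)| * (1 / R ^ A) :=
          (nearestIntDist_int_mul_le _ _).trans (by gcongr; exact hYm i)
      _ ≤ R ^ CF * (1 / R ^ (CF + 1)) := by
          gcongr
          · exact hh j₀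
          · omega
      _ = 1 / R := by rw [pow_succ]; field_simp
  · have hZ : Y j = ∑ θ ∈ Θ, c θ * ((n : ℝ) ^ θ - s θ) / H -
        ∑ i, (h (j.succAbove i) : ℝ) * (Y (j.succAbove i) / H) := by
      have h1 := hcomb fun θ => (n : ℝ) ^ θ - s θ
      rw [Fin.sum_univ_succAbove _ j] at h1
      rw [← sum_div, ← h1]
      simp only [← mul_div_assoc]
      rw [← sum_div, ← sub_div, add_sub_cancel_right, ← hH]
      rw [mul_div_cancel_left₀ _ hH0]
    have hterm : ∀ θ ∈ Θ, nearestIntDist (c θ * ((n : ℝ) ^ θ - s θ) / H) ≤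
        2 * R ^ (a * CW + v * L) / T := by
      intro θ hθ
      by_cases hθd : ∀ d : ℕ, θ ≠ d
      · have h1 := hqn θ hθ hθd
        rw [← le_div_iff₀ hT0] at h1
        refine (nearestIntDist_le_abs _).trans ?_
        rw [abs_div, abs_mul]
        have h2 : |(n : ℝ) ^ θ - s θ| ≤ 2 * (R ^ v) ^ L := by
          have h3 : (n : ℝ) ^ θ ≤ (R ^ v) ^ L := (hpow hn1' θ hθ).trans (by gcongr)
          have h4 : 1 ≤ (R ^ v) ^ L := one_le_pow₀ (one_le_pow₀ hR1)
          refine (abs_sub _ _).trans ?_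
          rw [abs_of_nonneg (Real.rpow_nonneg (by positivity) _)]
          linarith [hs θ hθ]
        calc _ ≤ (R ^ (a * CW) / T) * (2 * (R ^ v) ^ L) / 1 := by gcongr
          _ = _ := by rw [pow_add R (a * CW) (v * L), pow_mul R v L]; ring
      · push Not at hθd
        obtain ⟨d, rfl⟩ := hθd
        have h1 := hqd d hθ
        rw [← le_div_iff₀ hT0] at h1
        rw [hs0, sub_zero, Real.rpow_natCast]
        have hd1 : 1 ≤ d := by exact_mod_cast (hL _ hθ).1
        have hdL : d ≤ L := by exact_mod_cast (hL _ hθ).2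
        refine (nearestIntDist_mul_rpow_div_le hHne hd1 hdL hn1 _).trans ?_
        calc _ ≤ (R ^ (a * CW) / T) * (R ^ v) ^ L := by gcongr
          _ = R ^ (a * CW + v * L) / T := by
            rw [pow_add R (a * CW) (v * L), pow_mul R v L]; ring
          _ ≤ _ := by
            gcongr
            linarith [pow_pos hR0 (a * CW + v * L)]
    have hmain : ∑ θ ∈ Θ, nearestIntDist (c θ * ((n : ℝ) ^ θ - s θ) / H) ≤ 1 / R ^ 2 := by
      refine (sum_le_card_nsmul Θ _ _ hterm).trans ?_
      rw [nsmul_eq_mul]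
      calc (#Θ : ℝ) * (2 * R ^ (a * CW + v * L) / T)
          ≤ #Θ * (2 * R ^ (a * CW + v * L) / R ^ B) := by gcongr
        _ = (2 * #Θ) * R ^ (a * CW + v * L) / R ^ B := by ring
        _ ≤ R ^ κ * R ^ (a * CW + v * L) / R ^ B := by gcongr; exact hκ R hR
        _ = 1 / R ^ 2 := by
            rw [hB, pow_add R (a * CW + v * L + κ) 2, pow_add R (a * CW + v * L) κ]
            field_simp
    have hrest : ∑ i, nearestIntDist ((h (j.succAbove i) : ℝ) * (Y (j.succAbove i) / H)) ≤
        1 / R ^ 2 := by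
      refine (sum_le_card_nsmul univ _ (R ^ CF * (1 / R ^ A)) fun i _ => ?_).trans ?_
      · refine (nearestIntDist_int_mul_le _ _).trans ?_
        gcongr
        · exact nearestIntDist_nonneg _
        · exact hh _
        · exact hYm i
      · rw [card_univ, Fintype.card_fin, nsmul_eq_mul]
        calc (D : ℝ) * (R ^ CF * (1 / R ^ A)) ≤ R ^ D * (R ^ CF * (1 / R ^ (CF + D + 2))) := by
              gcongr
              · exact natCast_le_pow hR D
              · omega
          _ = 1 / R ^ 2 := by
              rw [pow_add, pow_add]
              field_simp
    rw [hZ]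
    have hfin : 1 / R ^ 2 + 1 / R ^ 2 ≤ 1 / R := by
      rw [← add_div, div_le_div_iff₀ (by positivity) hR0]
      nlinarith
    refine (nearestIntDist_sub_le _ _).trans (le_trans (add_le_add ?_ ?_) hfin)
    · exact (nearestIntDist_sum_le _ _).trans hmain
    · exact (nearestIntDist_sum_le _ _).trans hrest

theorem smallValues {Θ : Finset ℝ} (hΘ : ∀ θ ∈ Θ, 1 ≤ θ) (D : ℕ) : SmallValues Θ D := by
  induction D with
  | zero => exact ⟨0, fun R _ _ _ _ _ _ => ⟨1, le_rfl, by simp, fun j => j.elim0⟩⟩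
  | succ D ih => exact ih.succ hΘ

lemma exists_coeff_of_isPseudoPoly {f : ℝ → ℝ} (hf : IsPseudoPoly f) :
    ∃ (S : Finset ℝ) (c : ℝ → ℝ), (∀ θ ∈ S, 1 ≤ θ) ∧ (∀ θ, 0 ≤ c θ) ∧ (∀ θ ∉ S, c θ = 0) ∧
      (∃ θ ∈ S, (∀ d : ℕ, θ ≠ d) ∧ 0 < c θ) ∧ ∀ x, f x = ∑ θ ∈ S, c θ * x ^ θ := by
  obtain ⟨d, α, θ, hα, h1, hθ, ⟨i, hi⟩, hfx⟩ := hf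
  have hc : ∀ i, (∑ i', if θ i' = θ i then α i' else 0) = α i := by
    intro i
    simp [hθ.injective.eq_iff]
  refine ⟨univ.image θ, fun t => ∑ i, if θ i = t then α i else 0, ?_, ?_, ?_, ?_, ?_⟩
  · simp only [mem_image, mem_univ, true_and, forall_exists_index, forall_apply_eq_imp_iff]
    exact fun i => h1.trans (hθ.monotone (Fin.zero_le i))
  · intro t
    refine sum_nonneg fun i _ => ?_
    split_ifs
    · exact (hα i).le
    · exact le_rfl
  · intro t ht
    refine sum_eq_zero fun i _ => if_neg ?_
    rintro rfl
    exact ht (mem_image_of_mem _ (mem_univ _))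
  · exact ⟨θ i, mem_image_of_mem _ (mem_univ _), fun d => by exact_mod_cast hi d,
      (hα i).trans_eq (hc i).symm⟩
  · intro x
    rw [sum_image hθ.injective.injOn, hfx]
    exact sum_congr rfl fun i _ => by simp only [hc]

/-- A small shift to the right pins down the integer part. -/
lemma floor_eq_of_shift {y T K Q e : ℝ} {m : ℤ} (hK : 2 ≤ K) (hTK : T ≤ K) (hT : 0 < T)
    (hT' : 1 / T ≤ K) (hQ : 2 * K ≤ Q) (hy : y - T / Q = m + e) (he : |e| ≤ 1 / Q ^ 2) :
    ⌊y⌋ = m := by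
  have hQ0 : 0 < Q := by linarith
  obtain ⟨he1, he2⟩ := abs_le.mp he
  rw [Int.floor_eq_iff]
  have h1 : 1 / Q ^ 2 ≤ T / Q := by
    rw [div_le_div_iff₀ (by positivity) hQ0]
    rw [div_le_iff₀ hT] at hT'
    nlinarith
  have h2 : 1 / Q ^ 2 ≤ 1 / 4 := by
    apply one_div_le_one_div_of_le <;> nlinarith
  have h3 : T / Q ≤ 1 / 2 := by
    rw [div_le_div_iff₀ hQ0 (by norm_num)]
    linarith
  constructor <;> linarith

lemma exists_uniform_bound {k : ℕ} (l : ℕ) {f : Fin k → ℝ → ℝ} (hf : ∀ j, IsPseudoPoly (f j)) :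
    ∃ (C : ℕ) (K : ℝ), 2 ≤ K ∧ ∀ (A : Fin l → Fin k → ℝ) (Q : ℝ), 2 * K ≤ Q →
      ∃ n : ℕ, 1 ≤ n ∧ (n : ℝ) ≤ Q ^ C ∧
        ∀ i, nearestIntDist (∑ j, A i j * (⌊f j (n : ℝ)⌋ : ℝ)) ≤ (k + 1) / Q ^ 2 := by
  classical
  choose S c hS1 hc0 hcS hni hfx using fun j => exists_coeff_of_isPseudoPoly (hf j)
  set Θ := univ.biUnion S with hΘdef
  have hΘ : ∀ θ ∈ Θ, 1 ≤ θ := by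
    intro θ hθ
    obtain ⟨j, -, hj⟩ := mem_biUnion.mp hθ
    exact hS1 j θ hj
  have hSΘ : ∀ j, S j ⊆ Θ := fun j => subset_biUnion_of_mem S (mem_univ j)
  have hfΘ : ∀ j x, f j x = ∑ θ ∈ Θ, c j θ * x ^ θ := fun j x => by
    rw [hfx]
    exact sum_subset (hSΘ j) fun θ _ h => by rw [hcS j θ h, zero_mul]
  obtain ⟨C, hC⟩ := smallValues hΘ (k + l)
  set χ : ℝ → ℝ := fun θ => if ∃ d : ℕ, θ = d then 0 else 1 with hχ
  have hχ0 : ∀ θ, 0 ≤ χ θ := fun θ => by simp only [hχ]; split_ifs <;> norm_num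
  have hχ1 : ∀ θ, χ θ ≤ 1 := fun θ => by simp only [hχ]; split_ifs <;> norm_num
  set T : Fin k → ℝ := fun j => ∑ θ ∈ Θ, c j θ * χ θ with hT
  have hT0 : ∀ j, 0 < T j := by
    intro j
    obtain ⟨θ, hθ, hθd, hpos⟩ := hni j
    refine sum_pos' (fun θ _ => mul_nonneg (hc0 j θ) (hχ0 θ)) ⟨θ, hSΘ j hθ, ?_⟩
    have : χ θ = 1 := if_neg (by push Not; exact hθd)
    rwa [this, mul_one]
  have hinv : ∀ j, 0 ≤ 1 / T j := fun j => (one_div_pos.mpr (hT0 j)).le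
  have hcs : ∀ j, 0 ≤ ∑ θ ∈ Θ, c j θ := fun j => sum_nonneg fun θ _ => hc0 j θ
  set K : ℝ := 2 + ∑ j, (1 / T j + ∑ θ ∈ Θ, c j θ) with hK
  have hKj : ∀ j, 1 / T j + ∑ θ ∈ Θ, c j θ ≤ K := by
    intro j
    have := single_le_sum (f := fun j => 1 / T j + ∑ θ ∈ Θ, c j θ)
      (fun j _ => add_nonneg (hinv j) (hcs j)) (mem_univ j)
    linarith
  have hK2 : 2 ≤ K := by
    have : 0 ≤ ∑ j, (1 / T j + ∑ θ ∈ Θ, c j θ) :=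
      sum_nonneg fun j _ => add_nonneg (hinv j) (hcs j)
    linarith
  have hcK : ∀ θ ∈ Θ, ∑ j, c j θ ≤ K := by
    intro θ hθ
    have : ∑ j, c j θ ≤ ∑ j, (1 / T j + ∑ θ ∈ Θ, c j θ) := by
      refine sum_le_sum fun j _ => ?_
      have := single_le_sum (f := c j) (fun θ _ => hc0 j θ) hθ
      linarith [hinv j]
    linarith
  have hTK : ∀ j, T j ≤ K := by
    intro j
    have : T j ≤ ∑ θ ∈ Θ, c j θ :=
      sum_le_sum fun θ _ => mul_le_of_le_one_right (hc0 j θ) (hχ1 θ)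
    linarith [hKj j, hinv j]
  refine ⟨2 * C, K, hK2, fun A Q hQ => ?_⟩
  have hQ0 : 0 < Q := by linarith
  have hKQ : K ≤ Q ^ 2 := by nlinarith
  obtain ⟨n, hn1, hnQ, hn⟩ := hC (Q ^ 2) (by nlinarith)
    (Fin.append c fun i θ => ∑ j, Int.fract (A i j) * c j θ) (fun j θ hθ => by
      refine le_trans ?_ ((hcK θ hθ).trans hKQ)
      refine Fin.addCases (fun j => ?_) (fun i => ?_) j
      · rw [Fin.append_left, abs_of_nonneg (hc0 j θ)]
        exact single_le_sum (f := fun j => c j θ) (fun j _ => hc0 j θ) (mem_univ j)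
      · rw [Fin.append_right, abs_of_nonneg
          (sum_nonneg fun j _ => mul_nonneg (Int.fract_nonneg _) (hc0 j θ))]
        exact sum_le_sum fun j _ => mul_le_of_le_one_left (hc0 j θ) (Int.fract_lt_one _).le)
    (fun θ => χ θ / Q) (fun θ _ => by
      rw [abs_of_nonneg (div_nonneg (hχ0 θ) hQ0.le), div_le_one hQ0]
      linarith [hχ1 θ])
    (fun d => by simp [hχ])
  rw [← pow_mul] at hnQ
  refine ⟨n, hn1, hnQ, fun i => ?_⟩
  have hrow : ∀ j, ∑ θ ∈ Θ, c j θ * ((n : ℝ) ^ θ - χ θ / Q) = f j n - T j / Q := by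
    intro j
    rw [hfΘ, hT, sum_div, ← sum_sub_distrib]
    exact sum_congr rfl fun θ _ => by ring
  have hme : ∀ j, ∃ (m : ℤ) (e : ℝ), f j n - T j / Q = m + e ∧ |e| ≤ 1 / Q ^ 2 := by
    intro j
    obtain ⟨m, e, h, he⟩ := exists_eq_add_nearestIntDist (f j n - T j / Q)
    refine ⟨m, e, h, ?_⟩
    have := hn (Fin.castAdd l j)
    rwa [Fin.append_left, hrow, ← he] at this
  choose m e hm he using hme
  have hfl : ∀ j, ⌊f j n⌋ = m j := fun j => floor_eq_of_shift hK2 (hTK j) (hT0 j)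
    (by linarith [hKj j, hcs j]) hQ (hm j) (he j)
  have hF := hn (Fin.natAdd k i)
  rw [Fin.append_right] at hF
  have hsplit : ∑ j, A i j * (⌊f j (n : ℝ)⌋ : ℝ) =
      ((∑ j, ⌊A i j⌋ * m j : ℤ) : ℝ) +
        ((∑ θ ∈ Θ, (∑ j, Int.fract (A i j) * c j θ) * ((n : ℝ) ^ θ - χ θ / Q)) -
          ∑ j, Int.fract (A i j) * e j) := by
    have h1 : ∑ θ ∈ Θ, (∑ j, Int.fract (A i j) * c j θ) * ((n : ℝ) ^ θ - χ θ / Q) =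
        ∑ j, Int.fract (A i j) * (m j + e j) := by
      simp only [← hm, ← hrow, sum_mul, mul_sum]
      rw [sum_comm]
      exact sum_congr rfl fun _ _ => sum_congr rfl fun _ _ => by ring
    rw [h1, ← sum_sub_distrib]
    push_cast
    rw [← sum_add_distrib]
    refine sum_congr rfl fun j _ => ?_
    rw [hfl, Int.fract]
    ring
  rw [hsplit]
  refine (nearestIntDist_add_le _ _).trans ?_
  rw [nearestIntDist_intCast, zero_add]
  refine (nearestIntDist_sub_le _ _).trans ?_
  have he' : nearestIntDist (∑ j, Int.fract (A i j) * e j) ≤ k / Q ^ 2 := by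
    refine (nearestIntDist_le_abs _).trans ((abs_sum_le_sum_abs _ _).trans ?_)
    refine (sum_le_card_nsmul univ _ (1 / Q ^ 2) fun j _ => ?_).trans ?_
    · rw [abs_mul, Int.abs_fract]
      exact (mul_le_of_le_one_left (abs_nonneg _) (Int.fract_lt_one _).le).trans (he j)
    · rw [card_univ, Fintype.card_fin, nsmul_eq_mul, mul_one_div]
  calc _ ≤ 1 / Q ^ 2 + k / Q ^ 2 := add_le_add hF he'
    _ = (k + 1) / Q ^ 2 := by ring

end Heilbronn

/-- Let `ℓ, k ≥ 1` and let `f₁,…,f_k` be pseudo-polynomials that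
are linearly independent over `ℚ`. Then there exist `η > 0`, `C > 0` and `N₀`,
depending only on `ℓ` and the `fⱼ`, such that for every real `ℓ×k` matrix `A`
and every `N ≥ N₀`,
`min_{1 ≤ n ≤ N} max_{1 ≤ i ≤ ℓ} ‖Σⱼ a_{ij}⌊fⱼ(n)⌋‖ ≤ C·N^{-η}`. -/
theorem stmt_6 (l k : ℕ) (hl : 1 ≤ l) (hk : 1 ≤ k)
    (f : Fin k → ℝ → ℝ) (hf : ∀ j, IsPseudoPoly (f j))
    (hind : ∀ q : Fin k → ℚ, (∀ x : ℝ, ∑ j, (q j : ℝ) * f j x = 0) → q = 0) :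
    ∃ (η C : ℝ) (N₀ : ℕ), 0 < η ∧ 0 < C ∧
      ∀ (A : Fin l → Fin k → ℝ) (N : ℕ), N₀ ≤ N →
        ∃ n : ℕ, 1 ≤ n ∧ n ≤ N ∧
          ∀ i : Fin l,
            nearestIntDist (∑ j, A i j * (⌊f j (n : ℝ)⌋ : ℝ)) ≤ C * (N : ℝ) ^ (-η) := by
  obtain ⟨C, K, hK, h⟩ := Heilbronn.exists_uniform_bound l hf
  refine ⟨1 / (C + 1 : ℕ), k + 1, ⌈(2 * K) ^ (C + 1)⌉₊, by positivity, by positivity,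
    fun A N hN => ?_⟩
  have hN' : (2 * K) ^ (C + 1) ≤ (N : ℝ) := Nat.ceil_le.mp hN
  set Q : ℝ := (N : ℝ) ^ (1 / (C + 1 : ℕ) : ℝ) with hQ
  have hQN : Q ^ (C + 1) = N := by
    rw [hQ, one_div]
    exact Real.rpow_inv_natCast_pow N.cast_nonneg (by omega)
  have hQ0 : 0 ≤ Q := Real.rpow_nonneg N.cast_nonneg _
  have hKQ : 2 * K ≤ Q := by
    rw [← hQN] at hN'
    exact le_of_pow_le_pow_left₀ (by omega) hQ0 hN'
  have hQ1 : 1 ≤ Q := by linarith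
  obtain ⟨n, hn1, hnQ, hn⟩ := h A Q hKQ
  refine ⟨n, hn1, ?_, fun i => (hn i).trans ?_⟩
  · have : (n : ℝ) ≤ N := hnQ.trans (hQN ▸ pow_le_pow_right₀ hQ1 (by omega))
    exact_mod_cast this
  · rw [Real.rpow_neg N.cast_nonneg, ← hQ, ← div_eq_mul_inv]
    gcongr
    exact le_self_pow₀ hQ1 (by norm_num)
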